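/- Let u be a smooth divergence-free vector field on T³×[0,T], let Ā : T³×[0,T] → ℝ^{3×3} be smooth symmetric, let κ̄ : T³×[0,T] → (0,∞) be smooth, let τ > 0, and write D_t = ∂ₜ + u·∇. Assume, for a constant C: (1/2)κ̄ Id ≤ Ā ≤ 2κ̄ Id as quadratic forms; ‖D_tκ̄/κ̄‖_{L^∞} ≤ Cτ^{−1}; for every m ≥ 1, ‖κ̄^{(m−2)/2}∇^mĀ‖_{L^∞} ≤ Cτ^{−m/2} and ‖κ̄^{(m−2)/2}∇^mκ̄‖_{L^∞} ≤ Cτ^{−m/2}; and ‖κ̄^{(m−1)/2}∇^m u‖_{L^∞} ≤ Cτ^{−1}τ^{−(m−1)/2}. Let ρ̄ be the smooth solution of ∂ₜρ̄ + u·∇ρ̄ = div(Ā∇ρ̄) on T³×[0,T] and set D̄ = ∫₀^T ‖κ̄^{1/2}∇ρ̄(s)‖²_{L²} ds. Then for every n ≥ 1, with constants depending only on n and C: sup_{t≤T} ‖κ̄^{n/2}∇ⁿρ̄(t)‖²_{L²} + ∫₀^T ‖κ̄^{(n+1)/2}∇^{n+1}ρ̄‖²_{L²} dt ≤ C′(τ^{−n}D̄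 + ∑_{i=1}^{n} τ^{−(n−i)} ‖(κ̄^{i/2}∇^iρ̄)(0)‖²_{L²}); furthermore, for every multi-index α with |α| = n: ∫₀^T ‖κ̄^{n/2} D_t ∂^α ρ̄‖²_{L²} dt ≤ C′(τ^{−(n+1)}D̄ + ∑_{i=1}^{n+1} τ^{−(n+1−i)} ‖(κ̄^{i/2}∇^iρ̄)(0)‖²_{L²}). -/

import Mathlib

/-!
STATEMENT 9 (Lemma `l:energy_weighted`): weighted energy estimates for the
advection–diffusion equation `∂ₜρ̄ + u·∇ρ̄ = div(Ā∇ρ̄)` on the 3-torus.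
`D_t = ∂ₜ + u·∇` is `matD u`.  The weighted L² quantities
`‖κ̄^{n/2}∇ⁿρ̄(t)‖²_{L²} = ∫ κ̄ⁿ ‖∇ⁿρ̄‖²` are written with `iteratedFDeriv`.
The constants `C′` depend only on `n` and on the constant `C` of the assumptions
(they are quantified before all the data).
-/

open MeasureTheory Real Set Filter

noncomputable section

abbrev Ed (d : ℕ) : Type := EuclideanSpace ℝ (Fin d)
abbrev E3 : Type := Ed 3

def cube (d : ℕ) : Set (Ed d) := {x : Ed d | ∀ i, 0 ≤ x i ∧ x i < 1}

def SpacePeriodic {d : ℕ} {α : Type*} (f : Ed d → α) : Prop :=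
  ∀ (x : Ed d) (m : Fin d → ℤ),
    f (x + ∑ i, (m i : ℝ) • EuclideanSpace.single i (1:ℝ)) = f x

def spd {d : ℕ} (i : Fin d) (f : Ed d → ℝ) (x : Ed d) : ℝ :=
  fderiv ℝ f x (EuclideanSpace.single i (1:ℝ))

def divg {d : ℕ} (u : Ed d → Ed d) (x : Ed d) : ℝ :=
  ∑ i, spd i (fun y => u y i) x

abbrev M3 : Type := Fin 3 → Fin 3 → ℝ

def qf (A : M3) (v w : Fin 3 → ℝ) : ℝ := ∑ i, ∑ j, A i j * v i * w j

def SmoothTS {d : ℕ} {F : Type*} [NormedAddCommGroup F] [NormedSpace ℝ F]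
    (f : ℝ → Ed d → F) : Prop :=
  ContDiff ℝ (⊤ : ℕ∞) (fun p : ℝ × Ed d => f p.1 p.2)

/-- advective (material) derivative D_t = ∂ₜ + u·∇ -/
def matD {d : ℕ} (u : ℝ → Ed d → Ed d) (f : ℝ → Ed d → ℝ) (t : ℝ) (x : Ed d) : ℝ :=
  deriv (fun s => f s x) t + ∑ i, u t x i * spd i (f t) x

def pdPow {d : ℕ} (i : Fin d) : ℕ → (Ed d → ℝ) → Ed d → ℝ
  | 0, f => f
  | n+1, f => spd i (pdPow i n f)

def pdMulti {d : ℕ} (α : Fin d → ℕ) (f : Ed d → ℝ) : Ed d → ℝ :=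
  (List.finRange d).foldr (fun i g => pdPow i (α i) g) f

section Calculus

variable {d : ℕ}

theorem contDiff_spd {f : Ed d → ℝ} (hf : ContDiff ℝ (⊤ : ℕ∞) f) (i : Fin d) :
    ContDiff ℝ (⊤ : ℕ∞) (spd i f) :=
  (hf.fderiv_right (m := (⊤ : ℕ∞)) le_rfl).clm_apply contDiff_const

theorem spd_comm {f : Ed d → ℝ} (hf : ContDiff ℝ (⊤ : ℕ∞) f) (i j : Fin d) :
    spd i (spd j f) = spd j (spd i f) := by
  have hd : Differentiable ℝ (fderiv ℝ f) :=
    (hf.fderiv_right (m := (⊤ : ℕ∞)) le_rfl).differentiable (by simp)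
  have key : ∀ (a b : Fin d) (x : Ed d), spd a (spd b f) x =
      fderiv ℝ (fderiv ℝ f) x (EuclideanSpace.single a 1) (EuclideanSpace.single b 1) := by
    intro a b x
    unfold spd
    rw [fderiv_clm_apply (hd x) (differentiableAt_const _)]
    simp
  funext x
  rw [key, key]
  exact (hf.contDiffAt.isSymmSndFDerivAt
    (by
      simp only [minSmoothness_of_isRCLikeNormedField]
      exact WithTop.coe_le_coe.2 (le_top : (2 : ℕ∞) ≤ ⊤))) _ _

theorem spd_sub {f g : Ed d → ℝ} {x : Ed d} (hf : DifferentiableAt ℝ f x)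
    (hg : DifferentiableAt ℝ g x) (i : Fin d) :
    spd i (fun y => f y - g y) x = spd i f x - spd i g x := by
  simp [spd, fderiv_fun_sub hf hg]

theorem spd_mul {f g : Ed d → ℝ} {x : Ed d} (hf : DifferentiableAt ℝ f x)
    (hg : DifferentiableAt ℝ g x) (i : Fin d) :
    spd i (fun y => f y * g y) x = f x * spd i g x + spd i f x * g x := by
  simp [spd, fderiv_fun_mul hf hg]
  ring

theorem spd_const_mul {f : Ed d → ℝ} {x : Ed d} (hf : DifferentiableAt ℝ f x) (c : ℝ)
    (i : Fin d) : spd i (fun y => c * f y) x = c * spd i f x := by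
  simp [spd, fderiv_const_mul hf]

theorem spd_pow {f : Ed d → ℝ} {x : Ed d} (hf : DifferentiableAt ℝ f x) (n : ℕ) (i : Fin d) :
    spd i (fun y => f y ^ n) x = n * f x ^ (n - 1) * spd i f x := by
  simp [spd, fderiv_fun_pow n hf]

theorem norm_iteratedFDeriv_spd_le {f : Ed d → ℝ} (hf : ContDiff ℝ (⊤ : ℕ∞) f) (i : Fin d)
    (n : ℕ) (x : Ed d) :
    ‖iteratedFDeriv ℝ n (spd i f) x‖ ≤ ‖iteratedFDeriv ℝ (n + 1) f x‖ := by
  have h := norm_iteratedFDeriv_clm_apply_const (𝕜 := ℝ) (f := fderiv ℝ f)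
    (c := EuclideanSpace.single i (1 : ℝ)) (x := x) (N := (⊤ : ℕ∞)) (n := n)
    (hf.fderiv_right (m := (⊤ : ℕ∞)) le_rfl).contDiffAt (by exact_mod_cast le_top)
  rw [norm_iteratedFDeriv_fderiv] at h
  simpa [spd, Function.comp_def] using (show ‖iteratedFDeriv ℝ n (spd i f) x‖ ≤ _ from h)

/-- The derivative of `f` along the coordinate directions listed by `I`. -/
def wordDeriv {n : ℕ} (I : Fin n → Fin d) (f : Ed d → ℝ) (x : Ed d) : ℝ :=
  iteratedFDeriv ℝ n f x (fun k => EuclideanSpace.single (I k) (1 : ℝ))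

theorem wordDeriv_zero (I : Fin 0 → Fin d) (f : Ed d → ℝ) : wordDeriv I f = f := by
  funext x
  simp [wordDeriv]

theorem wordDeriv_cons {n : ℕ} {f : Ed d → ℝ} (hf : ContDiff ℝ (⊤ : ℕ∞) f) (i : Fin d)
    (I : Fin n → Fin d) :
    wordDeriv (Fin.cons i I : Fin (n + 1) → Fin d) f = spd i (wordDeriv I f) := by
  funext x
  have hd : DifferentiableAt ℝ (iteratedFDeriv ℝ n f) x :=
    (hf.differentiable_iteratedFDeriv (by exact_mod_cast ENat.natCast_lt_top n)) x
  simp only [wordDeriv, spd, iteratedFDeriv_succ_apply_left, Fin.cons_zero]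
  have h := fderiv_continuousMultilinear_apply_const_apply hd
    (fun k => EuclideanSpace.single (I k) (1 : ℝ)) (EuclideanSpace.single i (1 : ℝ))
  exact h.symm

theorem contDiff_wordDeriv {n : ℕ} {f : Ed d → ℝ} (hf : ContDiff ℝ (⊤ : ℕ∞) f)
    (I : Fin n → Fin d) : ContDiff ℝ (⊤ : ℕ∞) (wordDeriv I f) := by
  induction n with
  | zero => rwa [wordDeriv_zero]
  | succ n ih =>
    rw [← Fin.cons_self_tail I, wordDeriv_cons hf]
    exact contDiff_spd (ih _) _

theorem wordDeriv_spd {n : ℕ} {f : Ed d → ℝ} (hf : ContDiff ℝ (⊤ : ℕ∞) f) (i : Fin d)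
    (I : Fin n → Fin d) : wordDeriv I (spd i f) = spd i (wordDeriv I f) := by
  induction n with
  | zero => simp only [wordDeriv_zero]
  | succ n ih =>
    rw [← Fin.cons_self_tail I, wordDeriv_cons hf, wordDeriv_cons (contDiff_spd hf i), ih,
      spd_comm (contDiff_wordDeriv hf _)]

theorem wordDeriv_sum {n : ℕ} {ι : Type*} (s : Finset ι) {f : ι → Ed d → ℝ}
    (hf : ∀ j, ContDiff ℝ (⊤ : ℕ∞) (f j)) (I : Fin n → Fin d) (x : Ed d) :
    wordDeriv I (fun y => ∑ j ∈ s, f j y) x = ∑ j ∈ s, wordDeriv I (f j) x := by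
  unfold wordDeriv
  rw [iteratedFDeriv_fun_sum_apply fun j _ => (((hf j).of_le
    (by exact_mod_cast le_top)).contDiffAt)]
  simp

theorem wordDeriv_sub {n : ℕ} {f g : Ed d → ℝ} (hf : ContDiff ℝ (⊤ : ℕ∞) f)
    (hg : ContDiff ℝ (⊤ : ℕ∞) g) (I : Fin n → Fin d) (x : Ed d) :
    wordDeriv I (fun y => f y - g y) x = wordDeriv I f x - wordDeriv I g x := by
  unfold wordDeriv
  rw [fun_iteratedFDeriv_sub_apply ((hf.of_le (by exact_mod_cast le_top)).contDiffAt)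
    ((hg.of_le (by exact_mod_cast le_top)).contDiffAt)]
  simp

theorem abs_wordDeriv_le {n : ℕ} (I : Fin n → Fin d) (f : Ed d → ℝ) (x : Ed d) :
    |wordDeriv I f x| ≤ ‖iteratedFDeriv ℝ n f x‖ := by
  have h := (iteratedFDeriv ℝ n f x).le_opNorm
    (fun k => EuclideanSpace.single (I k) (1 : ℝ))
  simpa [wordDeriv] using h

theorem norm_iteratedFDeriv_le_sum_wordDeriv (n : ℕ) (f : Ed d → ℝ) (x : Ed d) :
    ‖iteratedFDeriv ℝ n f x‖ ≤ ∑ I : Fin n → Fin d, |wordDeriv I f x| := by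
  refine ContinuousMultilinearMap.opNorm_le_bound (by positivity) fun m => ?_
  have hm : m = fun k => ∑ i, m k i • EuclideanSpace.single i (1 : ℝ) := by
    funext k
    ext j
    simp [Pi.single_apply]
  conv_lhs => rw [hm]
  rw [ContinuousMultilinearMap.map_sum, Finset.sum_mul]
  refine (norm_sum_le _ _).trans (Finset.sum_le_sum fun I _ => ?_)
  rw [ContinuousMultilinearMap.map_smul_univ, norm_smul, mul_comm]
  refine mul_le_mul_of_nonneg_left ?_ (norm_nonneg _)
  rw [norm_prod]
  exact Finset.prod_le_prod (fun _ _ => norm_nonneg _)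
    fun k _ => PiLp.norm_apply_le (m k) (I k)

theorem sq_norm_iteratedFDeriv_le (n : ℕ) (f : Ed d → ℝ) (x : Ed d) :
    ‖iteratedFDeriv ℝ n f x‖ ^ 2 ≤ (d : ℝ) ^ n * ∑ I : Fin n → Fin d, wordDeriv I f x ^ 2 := by
  refine (pow_le_pow_left₀ (norm_nonneg _) (norm_iteratedFDeriv_le_sum_wordDeriv n f x) 2).trans ?_
  refine sq_sum_le_card_mul_sum_sq.trans (le_of_eq ?_)
  simp [Finset.card_univ]

theorem sum_sq_wordDeriv_le (n : ℕ) (f : Ed d → ℝ) (x : Ed d) :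
    ∑ I : Fin n → Fin d, wordDeriv I f x ^ 2 ≤ (d : ℝ) ^ n * ‖iteratedFDeriv ℝ n f x‖ ^ 2 := by
  refine (Finset.sum_le_card_nsmul _ _ (‖iteratedFDeriv ℝ n f x‖ ^ 2) fun I _ => ?_).trans
    (le_of_eq (by simp [Finset.card_univ]))
  rw [← sq_abs]
  exact pow_le_pow_left₀ (abs_nonneg _) (abs_wordDeriv_le I f x) 2

theorem sum_sq_wordDeriv_succ {f : Ed d → ℝ} (hf : ContDiff ℝ (⊤ : ℕ∞) f) (n : ℕ) (x : Ed d) :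
    ∑ I : Fin (n + 1) → Fin d, wordDeriv I f x ^ 2 =
      ∑ I : Fin n → Fin d, ∑ i, spd i (wordDeriv I f) x ^ 2 := by
  rw [Finset.sum_comm, ← Fintype.sum_prod_type',
    ← (Fin.consEquiv fun _ : Fin (n + 1) => Fin d).sum_comp]
  refine Finset.sum_congr rfl fun p _ => ?_
  rw [← wordDeriv_cons hf]
  rfl

theorem exists_wordDeriv_eq_pdMulti (α : Fin d → ℕ) :
    ∃ I : Fin (∑ i, α i) → Fin d,
      ∀ f : Ed d → ℝ, ContDiff ℝ (⊤ : ℕ∞) f → pdMulti α f = wordDeriv I f := by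
  have hpow : ∀ (i : Fin d) (k m : ℕ) (I : Fin m → Fin d), ∃ J : Fin (k + m) → Fin d,
      ∀ f : Ed d → ℝ, ContDiff ℝ (⊤ : ℕ∞) f → pdPow i k (wordDeriv I f) = wordDeriv J f := by
    intro i k m I
    induction k with
    | zero =>
      rw [Nat.zero_add]
      exact ⟨I, fun _ _ => rfl⟩
    | succ k ih =>
      obtain ⟨J, hJ⟩ := ih
      have e : k + 1 + m = k + m + 1 := by omega
      rw [e]
      exact ⟨Fin.cons i J, fun f hf => by rw [wordDeriv_cons hf, pdPow, hJ f hf]⟩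
  have hlist : ∀ l : List (Fin d), ∃ I : Fin (l.map α).sum → Fin d,
      ∀ f : Ed d → ℝ, ContDiff ℝ (⊤ : ℕ∞) f →
        l.foldr (fun i g => pdPow i (α i) g) f = wordDeriv I f := by
    intro l
    induction l with
    | nil => exact ⟨Fin.elim0, fun f _ => (wordDeriv_zero _ f).symm⟩
    | cons i l ih =>
      obtain ⟨I, hI⟩ := ih
      obtain ⟨J, hJ⟩ := hpow i (α i) _ I
      exact ⟨J, fun f hf => by rw [List.foldr_cons, hI f hf, hJ f hf]; rfl⟩
  have e : ∑ i, α i = ((List.finRange d).map α).sum := by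
    rw [← List.sum_ofFn, List.ofFn_eq_map]
  rw [e]
  exact hlist _

theorem norm_iteratedFDeriv_mul_spd_le {n : ℕ} {f g : Ed d → ℝ} (hf : ContDiff ℝ (⊤ : ℕ∞) f)
    (hg : ContDiff ℝ (⊤ : ℕ∞) g) (i : Fin d) (x : Ed d) :
    ‖iteratedFDeriv ℝ n (fun y => f y * spd i g y) x‖ ≤ ∑ k ∈ Finset.range (n + 1),
      (n.choose k : ℝ) * ‖iteratedFDeriv ℝ k f x‖ * ‖iteratedFDeriv ℝ (n - k + 1) g x‖ := by
  refine (norm_iteratedFDeriv_mul_le hf (contDiff_spd hg i) x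
    (by exact_mod_cast le_top)).trans (Finset.sum_le_sum fun k _ => ?_)
  gcongr
  exact norm_iteratedFDeriv_spd_le hg i _ x

/-- Subtracting the value `f x` removes the top order term of the Leibniz rule at `x`. -/
theorem abs_wordDeriv_mul_spd_sub_le {n : ℕ} {f g : Ed d → ℝ} (hf : ContDiff ℝ (⊤ : ℕ∞) f)
    (hg : ContDiff ℝ (⊤ : ℕ∞) g) (i : Fin d) (I : Fin n → Fin d) (x : Ed d) :
    |wordDeriv I (fun y => f y * spd i g y) x - f x * spd i (wordDeriv I g) x| ≤
      ∑ k ∈ Finset.range n, (n.choose (k + 1) : ℝ) * ‖iteratedFDeriv ℝ (k + 1) f x‖ *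
        ‖iteratedFDeriv ℝ (n - k) g x‖ := by
  have hc : ContDiff ℝ (⊤ : ℕ∞) fun y => f y - f x := hf.sub contDiff_const
  have hgi := contDiff_spd hg i
  have h1 : wordDeriv I (fun y => (f y - f x) * spd i g y) x =
      wordDeriv I (fun y => f y * spd i g y) x - f x * spd i (wordDeriv I g) x := by
    have e : (fun y => (f y - f x) * spd i g y) =
        fun y => f y * spd i g y - f x * spd i g y := by funext y; ring
    rw [e, wordDeriv_sub (hf.mul hgi) (contDiff_const.mul hgi), ← wordDeriv_spd hg]
    congr 1
    unfold wordDeriv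
    have := iteratedFDeriv_const_smul_apply' (𝕜 := ℝ) (i := n) (x := x) (a := f x)
      (f := spd i g) ((hgi.of_le (by exact_mod_cast le_top)).contDiffAt)
    simp only [smul_eq_mul] at this
    rw [this]
    simp
  rw [← h1]
  refine (abs_wordDeriv_le _ _ _).trans ((norm_iteratedFDeriv_mul_spd_le hc hg i x).trans ?_)
  rw [Finset.sum_range_succ']
  simp only [norm_iteratedFDeriv_zero, sub_self, norm_zero, mul_zero, zero_mul, add_zero]
  refine Finset.sum_le_sum fun k hk => ?_
  have hkn : n - (k + 1) + 1 = n - k := by have := Finset.mem_range.mp hk; omega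
  rw [hkn]
  have h2 : iteratedFDeriv ℝ (k + 1) (fun y => f y - f x) x = iteratedFDeriv ℝ (k + 1) f x := by
    rw [fun_iteratedFDeriv_sub_apply ((hf.of_le (by exact_mod_cast le_top)).contDiffAt)
      contDiffAt_const, iteratedFDeriv_succ_const]
    simp
  rw [h2]

end Calculus

section SpaceTime

variable {d : ℕ}

namespace SmoothTS

theorem slice {F : Type*} [NormedAddCommGroup F] [NormedSpace ℝ F] {f : ℝ → Ed d → F}
    (hf : SmoothTS f) (t : ℝ) : ContDiff ℝ (⊤ : ℕ∞) (f t) :=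
  ContDiff.comp (g := fun p : ℝ × Ed d => f p.1 p.2) hf (contDiff_const.prodMk contDiff_id)

theorem timeSlice {f : ℝ → Ed d → ℝ} (hf : SmoothTS f) (x : Ed d) :
    ContDiff ℝ (⊤ : ℕ∞) fun s => f s x :=
  ContDiff.comp (g := fun p : ℝ × Ed d => f p.1 p.2) hf (contDiff_id.prodMk contDiff_const)

theorem continuous {f : ℝ → Ed d → ℝ} (hf : SmoothTS f) :
    Continuous fun p : ℝ × Ed d => f p.1 p.2 :=
  ContDiff.continuous hf

theorem differentiableAt {f : ℝ → Ed d → ℝ} (hf : SmoothTS f) (t : ℝ) (x : Ed d) :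
    DifferentiableAt ℝ (f t) x :=
  (hf.slice t).differentiable (by simp) x

theorem differentiableAt_time {f : ℝ → Ed d → ℝ} (hf : SmoothTS f) (t : ℝ) (x : Ed d) :
    DifferentiableAt ℝ (fun s => f s x) t :=
  (hf.timeSlice x).differentiable (by simp) t

theorem sub {f g : ℝ → Ed d → ℝ} (hf : SmoothTS f) (hg : SmoothTS g) :
    SmoothTS fun t x => f t x - g t x :=
  ContDiff.sub hf hg

theorem mul {f g : ℝ → Ed d → ℝ} (hf : SmoothTS f) (hg : SmoothTS g) :
    SmoothTS fun t x => f t x * g t x :=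
  ContDiff.mul hf hg

theorem pow {f : ℝ → Ed d → ℝ} (hf : SmoothTS f) (n : ℕ) :
    SmoothTS fun t x => f t x ^ n :=
  ContDiff.pow hf n

theorem const_mul {f : ℝ → Ed d → ℝ} (hf : SmoothTS f) (c : ℝ) :
    SmoothTS fun t x => c * f t x :=
  contDiff_const.mul hf

theorem sum {ι : Type*} {s : Finset ι} {f : ι → ℝ → Ed d → ℝ} (hf : ∀ i, SmoothTS (f i)) :
    SmoothTS fun t x => ∑ i ∈ s, f i t x :=
  ContDiff.sum fun i _ => hf i

theorem hasFDerivAt {f : ℝ → Ed d → ℝ} (hf : SmoothTS f) (p : ℝ × Ed d) :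
    HasFDerivAt (fun p : ℝ × Ed d => f p.1 p.2) (fderiv ℝ (fun p : ℝ × Ed d => f p.1 p.2) p) p :=
  (ContDiff.differentiable hf (by simp) p).hasFDerivAt

theorem spd_eq {f : ℝ → Ed d → ℝ} (hf : SmoothTS f) (i : Fin d) (t : ℝ) (x : Ed d) :
    spd i (f t) x = fderiv ℝ (fun p : ℝ × Ed d => f p.1 p.2) (t, x)
      (0, EuclideanSpace.single i 1) := by
  have h := (hf.hasFDerivAt (t, x)).comp x
    ((hasFDerivAt_const t x).prodMk (hasFDerivAt_id x))
  have e : fderiv ℝ (f t) x = _ := h.fderiv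
  rw [spd, e]
  simp

theorem deriv_eq {f : ℝ → Ed d → ℝ} (hf : SmoothTS f) (t : ℝ) (x : Ed d) :
    deriv (fun s => f s x) t = fderiv ℝ (fun p : ℝ × Ed d => f p.1 p.2) (t, x) (1, 0) := by
  have h := (hf.hasFDerivAt (t, x)).comp_hasDerivAt t
    ((hasDerivAt_id t).prodMk (hasDerivAt_const t x))
  exact h.deriv

theorem contDiff_fderiv {f : ℝ → Ed d → ℝ} (hf : SmoothTS f) :
    ContDiff ℝ (⊤ : ℕ∞) (fderiv ℝ fun p : ℝ × Ed d => f p.1 p.2) :=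
  ContDiff.fderiv_right (m := (⊤ : ℕ∞)) hf le_rfl

theorem spd {f : ℝ → Ed d → ℝ} (hf : SmoothTS f) (i : Fin d) :
    SmoothTS fun t x => spd i (f t) x := by
  unfold SmoothTS
  simp only [hf.spd_eq]
  exact hf.contDiff_fderiv.clm_apply contDiff_const

theorem timeDeriv {f : ℝ → Ed d → ℝ} (hf : SmoothTS f) :
    SmoothTS fun t x => deriv (fun s => f s x) t := by
  unfold SmoothTS
  simp only [hf.deriv_eq]
  exact hf.contDiff_fderiv.clm_apply contDiff_const

theorem deriv_spd {f : ℝ → Ed d → ℝ} (hf : SmoothTS f) (i : Fin d) (t : ℝ) (x : Ed d) :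
    deriv (fun s => _root_.spd i (f s) x) t =
      _root_.spd i (fun y => deriv (fun s => f s y) t) x := by
  have hd := hf.contDiff_fderiv.differentiable (by simp)
  rw [(hf.spd i).deriv_eq, hf.timeDeriv.spd_eq]
  simp only [hf.spd_eq, hf.deriv_eq]
  rw [fderiv_clm_apply (hd _) (differentiableAt_const _),
    fderiv_clm_apply (hd _) (differentiableAt_const _)]
  have h : IsSymmSndFDerivAt ℝ (fun p : ℝ × Ed d => f p.1 p.2) (t, x) :=
    (ContDiff.contDiffAt hf).isSymmSndFDerivAt
      (by simp only [minSmoothness_of_isRCLikeNormedField]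
          exact WithTop.coe_le_coe.2 (le_top : (2 : ℕ∞) ≤ ⊤))
  simpa using h _ _

theorem wordDeriv {f : ℝ → Ed d → ℝ} (hf : SmoothTS f) {n : ℕ} (I : Fin n → Fin d) :
    SmoothTS fun t x => wordDeriv I (f t) x := by
  induction n with
  | zero => simpa only [wordDeriv_zero]
  | succ n ih =>
    rw [← Fin.cons_self_tail I]
    simp only [wordDeriv_cons (hf.slice _)]
    exact (ih _).spd _

theorem deriv_wordDeriv {f : ℝ → Ed d → ℝ} (hf : SmoothTS f) {n : ℕ} (I : Fin n → Fin d)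
    (t : ℝ) (x : Ed d) :
    deriv (fun s => _root_.wordDeriv I (f s) x) t =
      _root_.wordDeriv I (fun y => deriv (fun s => f s y) t) x := by
  induction n generalizing x with
  | zero => simp only [wordDeriv_zero]
  | succ n ih =>
    rw [← Fin.cons_self_tail I]
    simp only [wordDeriv_cons (hf.slice _), wordDeriv_cons (hf.timeDeriv.slice _)]
    rw [(hf.wordDeriv _).deriv_spd]
    congr 1
    funext y
    exact ih _ y

end SmoothTS

theorem SpacePeriodic.spd {f : Ed d → ℝ} (hf : SpacePeriodic f) (i : Fin d) :
    SpacePeriodic (spd i f) := by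
  intro x m
  unfold _root_.spd
  rw [← fderiv_comp_add_right]
  congr 2
  funext y
  exact hf y m

theorem SpacePeriodic.wordDeriv {f : Ed d → ℝ} (hs : ContDiff ℝ (⊤ : ℕ∞) f)
    (hf : SpacePeriodic f) {n : ℕ} (I : Fin n → Fin d) : SpacePeriodic (wordDeriv I f) := by
  induction n with
  | zero => rwa [wordDeriv_zero]
  | succ n ih =>
    rw [← Fin.cons_self_tail I, wordDeriv_cons hs]
    exact (ih _).spd _

end SpaceTime

section Integration

variable {d : ℕ}

theorem isCompact_image_Icc : IsCompact (WithLp.toLp 2 '' Icc (0 : Fin d → ℝ) 1) :=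
  isCompact_Icc.image (PiLp.continuous_toLp 2 _)

theorem cube_subset_image_Icc : cube d ⊆ WithLp.toLp 2 '' Icc (0 : Fin d → ℝ) 1 :=
  fun x hx => ⟨x.ofLp, ⟨fun i => (hx i).1, fun i => (hx i).2.le⟩, rfl⟩

theorem integrableOn_cube {g : Ed d → ℝ} (hg : Continuous g) : IntegrableOn g (cube d) :=
  (hg.continuousOn.integrableOn_compact isCompact_image_Icc).mono_set cube_subset_image_Icc

theorem integral_cube_eq (g : Ed d → ℝ) :
    ∫ x in cube d, g x = ∫ y in Icc (0 : Fin d → ℝ) 1, g (WithLp.toLp 2 y) := by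
  have h := (PiLp.volume_preserving_toLp (Fin d)).setIntegral_preimage_emb
    (MeasurableEquiv.toLp 2 (Fin d → ℝ)).measurableEmbedding g (cube d)
  rw [← h]
  have e : (WithLp.toLp 2 ⁻¹' cube d : Set (Fin d → ℝ)) =
      Set.pi univ fun _ => Ico (0 : ℝ) 1 := by
    ext y; simp [cube]
  rw [e]
  exact setIntegral_congr_set (Measure.univ_pi_Ico_ae_eq_Icc (f := 0) (g := 1))

theorem continuous_integral_cube {g : ℝ → Ed d → ℝ}
    (hg : Continuous fun p : ℝ × Ed d => g p.1 p.2) :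
    Continuous fun t => ∫ x in cube d, g t x := by
  simp only [integral_cube_eq]
  refine continuous_parametric_integral_of_continuous
    (f := fun t (y : Fin d → ℝ) => g t (WithLp.toLp 2 y)) ?_ isCompact_Icc
  exact hg.comp (continuous_fst.prodMk ((PiLp.continuous_toLp 2 _).comp continuous_snd))

theorem integral_cube_sub_eq {f : ℝ → Ed d → ℝ} (hf : SmoothTS f) (a b : ℝ) :
    (∫ x in cube d, f b x) - ∫ x in cube d, f a x =
      ∫ s in a..b, ∫ x in cube d, deriv (fun s => f s x) s := by
  have hc := hf.timeDeriv.continuous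
  rw [intervalIntegral_integral_swap, ← integral_sub (integrableOn_cube (hf.slice b).continuous)
    (integrableOn_cube (hf.slice a).continuous)]
  · refine integral_congr_ae (Eventually.of_forall fun x => ?_)
    refine (intervalIntegral.integral_deriv_eq_sub
      (fun s _ => hf.differentiableAt_time s x) ?_).symm
    exact (hc.comp (continuous_id.prodMk continuous_const)).intervalIntegrable a b
  · rw [Measure.prod_restrict]
    refine IntegrableOn.mono_set (hc.continuousOn.integrableOn_compact
      (isCompact_uIcc.prod isCompact_image_Icc)) (prod_mono uIoc_subset_uIcc cube_subset_image_Icc)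

theorem integral_cube_spd_eq_zero {g : E3 → ℝ} (hs : ContDiff ℝ (⊤ : ℕ∞) g)
    (hp : SpacePeriodic g) (i : Fin 3) : ∫ x in cube 3, spd i g x = 0 := by
  classical
  rw [integral_cube_eq]
  let L : (Fin 3 → ℝ) →L[ℝ] E3 :=
    ((EuclideanSpace.equiv (Fin 3) ℝ).symm : (Fin 3 → ℝ) →L[ℝ] EuclideanSpace ℝ (Fin 3))
  have hLa : ∀ y, L y = WithLp.toLp 2 y := fun y => rfl
  have hcd : ContDiff ℝ (⊤ : ℕ∞) fun y => g (L y) := hs.comp L.contDiff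
  have hd : ∀ y, HasFDerivAt (fun y => g (L y)) ((fderiv ℝ g (L y)).comp L) y := fun y =>
    (hs.differentiable (by simp) (L y)).hasFDerivAt.comp y L.hasFDerivAt
  have hsum : ∀ y : Fin 3 → ℝ, ∑ j, (if j = i then (fderiv ℝ g (L y)).comp L else 0)
      (Pi.single j 1) = spd i g (WithLp.toLp 2 y) := by
    intro y
    rw [Finset.sum_eq_single i (fun j _ hj => by simp [hj]) (by simp), if_pos rfl]
    rfl
  have key := integral_divergence_of_hasFDerivAt_off_countable' (n := 2) (E := ℝ)
    (0 : Fin 3 → ℝ) 1 zero_le_one (fun j y => if j = i then g (L y) else 0)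
    (fun j y => if j = i then (fderiv ℝ g (L y)).comp L else 0) ∅ countable_empty
    (fun j => by
      by_cases h : j = i
      · simpa only [h, if_true] using hcd.continuous.continuousOn
      · simpa only [h, if_false] using continuousOn_const)
    (fun y _ j => by
      by_cases h : j = i
      · simpa only [h, if_true] using hd y
      · simpa only [h, if_false] using hasFDerivAt_const (0 : ℝ) y)
    (by
      simp only [hsum]
      exact ((contDiff_spd hs i).continuous.comp
        (PiLp.continuous_toLp 2 _)).continuousOn.integrableOn_compact isCompact_Icc)
  simp only [hsum] at key
  rw [key]
  refine Finset.sum_eq_zero fun j _ => ?_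
  by_cases h : j = i
  · subst h
    simp only [if_true]
    rw [sub_eq_zero]
    refine integral_congr_ae (Eventually.of_forall fun x => ?_)
    have hp' := hp (L (j.insertNth (0 : ℝ) x)) (Pi.single j 1)
    have e : L (j.insertNth (0 : ℝ) x) +
        ∑ k, ((Pi.single j 1 : Fin 3 → ℤ) k : ℝ) • EuclideanSpace.single k (1 : ℝ) =
        L (j.insertNth (1 : ℝ) x) := by
      rw [Finset.sum_eq_single j (fun k _ hk => by simp [hk]) (by simp)]
      ext k
      refine Fin.succAboveCases j ?_ (fun k => ?_) k
      · simp [hLa]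
      · simp [hLa]
    rw [e] at hp'
    exact hp'
  · simp [h]

end Integration

section Pointwise

variable {d : ℕ}

/-- The scaled sum `∑ θⁿ⁻ᵏ σᵏ ‖∇ᵏg‖` over `1 ≤ k ≤ n`. -/
def scaledJet (σ θ : ℝ) (n : ℕ) (g : Ed d → ℝ) (x : Ed d) : ℝ :=
  ∑ k ∈ Finset.Icc 1 n, θ ^ (n - k) * (σ ^ k * ‖iteratedFDeriv ℝ k g x‖)

theorem le_scaledJet {σ θ : ℝ} (hσ : 0 ≤ σ) (hθ : 0 ≤ θ) {n k : ℕ} (hk : 1 ≤ k) (hkn : k ≤ n)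
    (g : Ed d → ℝ) (x : Ed d) :
    θ ^ (n - k) * (σ ^ k * ‖iteratedFDeriv ℝ k g x‖) ≤ scaledJet σ θ n g x :=
  Finset.single_le_sum (f := fun k => θ ^ (n - k) * (σ ^ k * ‖iteratedFDeriv ℝ k g x‖))
    (fun _ _ => by positivity) (Finset.mem_Icc.2 ⟨hk, hkn⟩)

theorem scaledJet_nonneg {σ θ : ℝ} (hσ : 0 ≤ σ) (hθ : 0 ≤ θ) (n : ℕ)
    (g : Ed d → ℝ) (x : Ed d) : 0 ≤ scaledJet σ θ n g x :=
  Finset.sum_nonneg fun _ _ => by positivity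

theorem scaledJet_succ (σ θ : ℝ) (n : ℕ) (g : Ed d → ℝ) (x : Ed d) :
    scaledJet σ θ (n + 1) g x =
      θ * scaledJet σ θ n g x + σ ^ (n + 1) * ‖iteratedFDeriv ℝ (n + 1) g x‖ := by
  unfold scaledJet
  rw [Finset.sum_Icc_succ_top (by omega), Finset.mul_sum]
  congr 1
  · refine Finset.sum_congr rfl fun k hk => ?_
    have := (Finset.mem_Icc.1 hk).2
    rw [show n + 1 - k = (n - k) + 1 by omega]
    ring
  · simp

theorem sq_scaledJet_le {κ r : ℝ} (hκ : 0 ≤ κ) (hr : 0 ≤ r) (n : ℕ) (g : Ed d → ℝ) (x : Ed d) :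
    scaledJet √κ √r n g x ^ 2 ≤ n * ((d : ℝ) + 1) ^ n * ∑ k ∈ Finset.Icc 1 n,
      r ^ (n - k) * (κ ^ k * ∑ I : Fin k → Fin d, wordDeriv I g x ^ 2) := by
  refine sq_sum_le_card_mul_sum_sq.trans ?_
  rw [Nat.card_Icc, Nat.add_sub_cancel, mul_assoc, Finset.mul_sum (a := ((d : ℝ) + 1) ^ n)]
  refine mul_le_mul_of_nonneg_left (Finset.sum_le_sum fun k hk => ?_) (Nat.cast_nonneg n)
  rw [mul_pow, mul_pow, ← pow_mul, ← pow_mul, mul_comm (n - k), mul_comm k, pow_mul, pow_mul,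
    Real.sq_sqrt hr, Real.sq_sqrt hκ]
  have h1 := sq_norm_iteratedFDeriv_le k g x
  have h2 : (d : ℝ) ^ k ≤ ((d : ℝ) + 1) ^ n :=
    (pow_le_pow_left₀ (by positivity) (by linarith) k).trans
      (pow_le_pow_right₀ (by linarith [Nat.cast_nonneg (α := ℝ) d]) (Finset.mem_Icc.1 hk).2)
  have hS : 0 ≤ ∑ I : Fin k → Fin d, wordDeriv I g x ^ 2 := by positivity
  calc r ^ (n - k) * (κ ^ k * ‖iteratedFDeriv ℝ k g x‖ ^ 2)
      ≤ r ^ (n - k) * (κ ^ k * (((d : ℝ) + 1) ^ n * ∑ I : Fin k → Fin d, wordDeriv I g x ^ 2)) := by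
        gcongr
        exact h1.trans (mul_le_mul_of_nonneg_right h2 hS)
    _ = _ := by ring

theorem pow_mul_commutator_le {σ θ B : ℝ} (hσ : 0 ≤ σ) (hθ : 0 ≤ θ) (hB : 0 ≤ B) {n : ℕ}
    {f g : Ed d → ℝ} (hf : ContDiff ℝ (⊤ : ℕ∞) f) (hg : ContDiff ℝ (⊤ : ℕ∞) g) {x : Ed d}
    (hfB : ∀ k, 1 ≤ k → σ ^ k * ‖iteratedFDeriv ℝ k f x‖ ≤ B * θ ^ k)
    (i : Fin d) (I : Fin n → Fin d) :
    σ ^ (n + 1) * |wordDeriv I (fun y => f y * spd i g y) x - f x * spd i (wordDeriv I g) x| ≤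
      2 ^ n * (B * (θ * scaledJet σ θ n g x)) := by
  have hJ := scaledJet_nonneg hσ hθ n g x
  have hterm : ∀ k ∈ Finset.range n, σ ^ (n + 1) * ((n.choose (k + 1) : ℝ) *
      ‖iteratedFDeriv ℝ (k + 1) f x‖ * ‖iteratedFDeriv ℝ (n - k) g x‖) ≤
      (n.choose (k + 1) : ℝ) * (B * (θ * scaledJet σ θ n g x)) := by
    intro k hk
    have hkn := Finset.mem_range.1 hk
    have h1 := hfB (k + 1) (by omega)
    have h2 := le_scaledJet hσ hθ (n := n) (k := n - k) (by omega) (by omega) g x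
    rw [show n - (n - k) = k by omega] at h2
    rw [show n + 1 = (k + 1) + (n - k) by omega, pow_add]
    calc _ = (n.choose (k + 1) : ℝ) * ((σ ^ (k + 1) * ‖iteratedFDeriv ℝ (k + 1) f x‖) *
            (σ ^ (n - k) * ‖iteratedFDeriv ℝ (n - k) g x‖)) := by ring
      _ ≤ (n.choose (k + 1) : ℝ) * ((B * θ ^ (k + 1)) *
            (σ ^ (n - k) * ‖iteratedFDeriv ℝ (n - k) g x‖)) := by gcongr
      _ = (n.choose (k + 1) : ℝ) * (B * (θ * (θ ^ k *
            (σ ^ (n - k) * ‖iteratedFDeriv ℝ (n - k) g x‖)))) := by ring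
      _ ≤ _ := by gcongr
  refine (mul_le_mul_of_nonneg_left (abs_wordDeriv_mul_spd_sub_le hf hg i I x)
    (by positivity)).trans ?_
  rw [Finset.mul_sum]
  refine (Finset.sum_le_sum hterm).trans ?_
  rw [← Finset.sum_mul]
  refine mul_le_mul_of_nonneg_right ?_ (by positivity)
  have h := Nat.sum_range_choose n
  rw [Finset.sum_range_succ'] at h
  have h' : ∑ k ∈ Finset.range n, n.choose (k + 1) ≤ 2 ^ n := by omega
  exact_mod_cast h'

theorem pow_mul_norm_iteratedFDeriv_mul_spd_le {σ θ B : ℝ} (hσ : 0 ≤ σ) (hθ : 0 ≤ θ) (hB : 0 ≤ B)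
    (n : ℕ) {f g : Ed d → ℝ} (hf : ContDiff ℝ (⊤ : ℕ∞) f) (hg : ContDiff ℝ (⊤ : ℕ∞) g)
    {x : Ed d} (hfB : ∀ k, σ ^ k * ‖iteratedFDeriv ℝ k f x‖ ≤ B * θ ^ k) (i : Fin d) :
    σ ^ (n + 1) * ‖iteratedFDeriv ℝ n (fun y => f y * spd i g y) x‖ ≤
      2 ^ n * (B * scaledJet σ θ (n + 1) g x) := by
  have hterm : ∀ k ∈ Finset.range (n + 1), σ ^ (n + 1) * ((n.choose k : ℝ) *
      ‖iteratedFDeriv ℝ k f x‖ * ‖iteratedFDeriv ℝ (n - k + 1) g x‖) ≤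
      (n.choose k : ℝ) * (B * scaledJet σ θ (n + 1) g x) := by
    intro k hk
    have hkn := Finset.mem_range.1 hk
    have h1 := hfB k
    have h2 := le_scaledJet hσ hθ (n := n + 1) (k := n - k + 1) (by omega) (by omega) g x
    rw [show n + 1 - (n - k + 1) = k by omega] at h2
    rw [show n + 1 = k + (n - k + 1) by omega, pow_add]
    rw [show k + (n - k + 1) = n + 1 by omega]
    calc _ = (n.choose k : ℝ) * ((σ ^ k * ‖iteratedFDeriv ℝ k f x‖) *
            (σ ^ (n - k + 1) * ‖iteratedFDeriv ℝ (n - k + 1) g x‖)) := by ring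
      _ ≤ (n.choose k : ℝ) * ((B * θ ^ k) *
            (σ ^ (n - k + 1) * ‖iteratedFDeriv ℝ (n - k + 1) g x‖)) := by gcongr
      _ = (n.choose k : ℝ) * (B * (θ ^ k *
            (σ ^ (n - k + 1) * ‖iteratedFDeriv ℝ (n - k + 1) g x‖))) := by ring
      _ ≤ _ := by gcongr
  refine (mul_le_mul_of_nonneg_left (norm_iteratedFDeriv_mul_spd_le hf hg i x)
    (by positivity)).trans ?_
  rw [Finset.mul_sum]
  refine (Finset.sum_le_sum hterm).trans (le_of_eq ?_)
  rw [← Finset.sum_mul]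
  congr 1
  exact_mod_cast Nat.sum_range_choose n

theorem two_mul_abs_mul_le {a b : ℝ} : 2 * (|a| * |b|) ≤ a ^ 2 / 8 + 8 * b ^ 2 := by
  nlinarith [sq_nonneg (|a| - 8 * |b|), sq_abs a, sq_abs b]

/-- The quadratic form estimate behind the energy inequality, in scaled variables. -/
theorem scaled_dissipation_le {N C c w a R β : ℝ} {q k δ : Fin 3 → ℝ} {A : Fin 3 → Fin 3 → ℝ}
    (hN : 0 ≤ N) (hC : 0 ≤ C) {θ M : ℝ} (hθ : 0 ≤ θ) (hM : 0 ≤ M) (hw : w = θ * M)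
    (ha : |a| ≤ M) (hR : |R| ≤ c * (θ * w)) (hβ : |β| ≤ C * θ ^ 2)
    (hk : ∀ i, |k i| ≤ c * w) (hδ : ∀ i, |δ i| ≤ C * θ) (hA : ∀ i j, |A i j| ≤ 2)
    (hell : (1 / 2) * ∑ i, q i ^ 2 ≤ ∑ i, ∑ j, A i j * q i * q j) :
    N * β * a ^ 2 + 2 * a * R - 2 * ∑ i, (q i + N * δ i * a) * (∑ j, A i j * q j + k i) ≤
      -(1 / 2) * ∑ i, q i ^ 2 +
        (N * C + 2 * c + 24 * c ^ 2 + 864 * N ^ 2 * C ^ 2 + 6 * N * C * c) * w ^ 2 := by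
  have hw0 : 0 ≤ w := by rw [hw]; positivity
  have hδa : ∀ i, |δ i * a| ≤ C * w := by
    intro i
    rw [abs_mul, hw]
    calc |δ i| * |a| ≤ (C * θ) * M := mul_le_mul (hδ i) ha (abs_nonneg _) (by positivity)
      _ = _ := by ring
  have h1 : N * β * a ^ 2 ≤ N * C * w ^ 2 := by
    have hb : β * a ^ 2 ≤ C * w ^ 2 := by
      calc β * a ^ 2 ≤ |β| * |a| ^ 2 := by
            rw [sq_abs]; exact mul_le_mul_of_nonneg_right (le_abs_self _) (sq_nonneg _)
        _ ≤ (C * θ ^ 2) * M ^ 2 := by gcongr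
        _ = _ := by rw [hw]; ring
    nlinarith
  have h2 : 2 * a * R ≤ 2 * c * w ^ 2 := by
    have hb : a * R ≤ c * w ^ 2 := by
      calc a * R ≤ |a| * |R| := by rw [← abs_mul]; exact le_abs_self _
        _ ≤ M * (c * (θ * w)) := by gcongr
        _ = _ := by rw [hw]; ring
    linarith
  have h3 : ∀ i, -2 * (q i * k i) ≤ q i ^ 2 / 8 + 8 * c ^ 2 * w ^ 2 := by
    intro i
    have e1 : -2 * (q i * k i) ≤ 2 * (|q i| * |c * w|) := by
      have h4 : |q i| * |k i| ≤ |q i| * |c * w| :=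
        mul_le_mul_of_nonneg_left ((hk i).trans (le_abs_self _)) (abs_nonneg _)
      have h5 := neg_abs_le (q i * k i)
      rw [abs_mul] at h5
      linarith
    have e2 := two_mul_abs_mul_le (a := q i) (b := c * w)
    linarith [mul_pow c w 2]
  have h4 : ∀ i, -2 * (N * (δ i * a) * k i) ≤ 2 * N * C * c * w ^ 2 := by
    intro i
    have h5 : |δ i * a| * |k i| ≤ (C * w) * (c * w) :=
      mul_le_mul (hδa i) (hk i) (abs_nonneg _) (by positivity)
    have h6 := neg_abs_le (δ i * a * k i)
    rw [abs_mul] at h6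
    nlinarith
  have h5 : ∀ i j, -2 * (N * (δ i * a) * (A i j * q j)) ≤
      q j ^ 2 / 24 + 96 * N ^ 2 * C ^ 2 * w ^ 2 := by
    intro i j
    have e1 : |δ i * a| * |A i j| ≤ C * w * 2 :=
      mul_le_mul (hδa i) (hA i j) (abs_nonneg _) (by positivity)
    have e2 : |δ i * a| * |A i j| * |q j| ≤ C * w * 2 * |q j| :=
      mul_le_mul_of_nonneg_right e1 (abs_nonneg _)
    have e3 := neg_abs_le (δ i * a * (A i j * q j))
    rw [abs_mul, abs_mul (A i j)] at e3
    have e4 : -2 * (N * (δ i * a) * (A i j * q j)) ≤ 4 * N * C * w * |q j| := by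
      nlinarith
    nlinarith [sq_nonneg (|q j| - 48 * (N * C * w)), sq_abs (q j)]
  have hexp : N * β * a ^ 2 + 2 * a * R -
      2 * ∑ i, (q i + N * δ i * a) * (∑ j, A i j * q j + k i) =
      N * β * a ^ 2 + 2 * a * R - 2 * (∑ i, ∑ j, A i j * q i * q j) +
        (∑ i, -2 * (q i * k i)) + (∑ i, -2 * (N * (δ i * a) * k i)) +
        ∑ i, ∑ j, -2 * (N * (δ i * a) * (A i j * q j)) := by
    simp only [Fin.sum_univ_three]
    ring
  have s3 := Finset.sum_le_sum fun i (_ : i ∈ Finset.univ) => h3 i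
  have s4 := Finset.sum_le_sum fun i (_ : i ∈ Finset.univ) => h4 i
  have s5 := Finset.sum_le_sum fun i (_ : i ∈ Finset.univ) =>
    Finset.sum_le_sum fun j (_ : j ∈ Finset.univ) => h5 i j
  rw [hexp]
  simp only [Fin.sum_univ_three] at *
  linarith [sq_nonneg (q 0), sq_nonneg (q 1), sq_nonneg (q 2)]

end Pointwise

section Energy

/-- The standing assumptions on the velocity `u`, the diffusion matrix `Ab` and the weight `κb`. -/
structure AdmissibleCoefficients (C T τ : ℝ) (u : ℝ → E3 → E3) (Ab : ℝ → E3 → M3)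
    (κb : ℝ → E3 → ℝ) : Prop where
  C_pos : 0 < C
  T_pos : 0 < T
  τ_pos : 0 < τ
  smooth_u : SmoothTS u
  periodic_u : ∀ t, SpacePeriodic (u t)
  div_u : ∀ t x, divg (u t) x = 0
  smooth_A : SmoothTS Ab
  periodic_A : ∀ t, SpacePeriodic (Ab t)
  symm_A : ∀ t x i j, Ab t x i j = Ab t x j i
  smooth_κ : SmoothTS κb
  periodic_κ : ∀ t, SpacePeriodic (κb t)
  κ_pos : ∀ t x, 0 < κb t x
  elliptic : ∀ t ∈ Icc (0:ℝ) T, ∀ x, ∀ v : Fin 3 → ℝ,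
    (1/2) * κb t x * (∑ i, (v i)^2) ≤ qf (Ab t x) v v ∧
    qf (Ab t x) v v ≤ 2 * κb t x * (∑ i, (v i)^2)
  matD_κ : ∀ t ∈ Icc (0:ℝ) T, ∀ x, |matD u κb t x| ≤ C * τ⁻¹ * κb t x
  deriv_A_κ : ∀ m : ℕ, 1 ≤ m → ∀ t ∈ Icc (0:ℝ) T, ∀ x,
    (κb t x) ^ (((m:ℝ) - 2)/2) * ‖iteratedFDeriv ℝ m (Ab t) x‖
      ≤ C * τ⁻¹ ^ ((m:ℝ)/2) ∧
    (κb t x) ^ (((m:ℝ) - 2)/2) * ‖iteratedFDeriv ℝ m (κb t) x‖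
      ≤ C * τ⁻¹ ^ ((m:ℝ)/2)
  deriv_u : ∀ m : ℕ, 1 ≤ m → ∀ t ∈ Icc (0:ℝ) T, ∀ x,
    (κb t x) ^ (((m:ℝ) - 1)/2) * ‖iteratedFDeriv ℝ m (u t) x‖
      ≤ C * τ⁻¹ * τ⁻¹ ^ (((m:ℝ) - 1)/2)

theorem sqrt_pow_mul_le_of_rpow_sub_two {κ r C N : ℝ} (hκ : 0 < κ) (hr : 0 < r) {m : ℕ}
    (h : κ ^ (((m:ℝ) - 2)/2) * N ≤ C * r ^ ((m:ℝ)/2)) :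
    √κ ^ m * N ≤ C * √κ ^ 2 * √r ^ m := by
  have hs : 0 < √κ := Real.sqrt_pos.2 hκ
  rw [Real.rpow_div_two_eq_sqrt _ hκ.le, Real.rpow_div_two_eq_sqrt _ hr.le, Real.rpow_natCast,
    Real.rpow_sub hs, Real.rpow_natCast, Real.rpow_ofNat, div_mul_eq_mul_div,
    div_le_iff₀ (by positivity)] at h
  linarith

theorem sqrt_pow_mul_le_of_rpow_sub_one {κ r C N : ℝ} (hκ : 0 < κ) (hr : 0 < r) {m : ℕ}
    (h : κ ^ (((m:ℝ) - 1)/2) * N ≤ C * r * r ^ (((m:ℝ) - 1)/2)) :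
    √κ ^ m * N ≤ C * (√κ * √r) * √r ^ m := by
  have hs : 0 < √κ := Real.sqrt_pos.2 hκ
  have hs' : 0 < √r := Real.sqrt_pos.2 hr
  rw [Real.rpow_div_two_eq_sqrt _ hκ.le, Real.rpow_div_two_eq_sqrt _ hr.le,
    Real.rpow_sub hs, Real.rpow_sub hs', Real.rpow_natCast, Real.rpow_natCast, Real.rpow_one,
    Real.rpow_one, div_mul_eq_mul_div, div_le_iff₀ hs] at h
  have e : C * r * (√r ^ m / √r) * √κ = C * (√κ * √r) * √r ^ m := by
    have := Real.mul_self_sqrt hr.le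
    field_simp
    rw [Real.sq_sqrt hr.le]
  linarith

namespace AdmissibleCoefficients

variable {C T τ : ℝ} {u : ℝ → E3 → E3} {Ab : ℝ → E3 → M3} {κb : ℝ → E3 → ℝ}

theorem smooth_u_apply (H : AdmissibleCoefficients C T τ u Ab κb) (i : Fin 3) :
    SmoothTS fun t x => u t x i :=
  (EuclideanSpace.proj (𝕜 := ℝ) i).contDiff.comp H.smooth_u

theorem smooth_A_apply (H : AdmissibleCoefficients C T τ u Ab κb) (i j : Fin 3) :
    SmoothTS fun t x => Ab t x i j :=
  contDiff_pi.1 (contDiff_pi.1 H.smooth_A i) j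

theorem abs_A_apply_le (H : AdmissibleCoefficients C T τ u Ab κb) {t : ℝ} (ht : t ∈ Icc (0:ℝ) T)
    (x : E3) (i j : Fin 3) : |Ab t x i j| ≤ 2 * κb t x := by
  have hd : ∀ i, qf (Ab t x) (Pi.single i 1) (Pi.single i 1) = Ab t x i i := by
    intro i
    fin_cases i <;> simp [qf, Fin.sum_univ_three]
  have hs : ∀ i : Fin 3, ∑ k, ((Pi.single i 1 : Fin 3 → ℝ) k) ^ 2 = 1 := by
    intro i
    fin_cases i <;> simp [Fin.sum_univ_three]
  have hκ := H.κ_pos t x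
  have hii : ∀ i, 1 / 2 * κb t x ≤ Ab t x i i ∧ Ab t x i i ≤ 2 * κb t x := by
    intro i
    have h := H.elliptic t ht x (Pi.single i 1)
    rw [hd, hs] at h
    constructor <;> linarith [h.1, h.2]
  by_cases hij : i = j
  · subst hij
    rw [abs_le]
    constructor <;> linarith [(hii i).1, (hii i).2]
  · have h := H.elliptic t ht x (Pi.single i 1 + Pi.single j 1)
    have h1 : qf (Ab t x) (Pi.single i 1 + Pi.single j 1) (Pi.single i 1 + Pi.single j 1) =
        Ab t x i i + Ab t x j j + 2 * Ab t x i j := by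
      have := H.symm_A t x i j
      fin_cases i <;> fin_cases j <;> simp [qf, Fin.sum_univ_three] at * <;> linarith
    have h2 : ∑ k, ((Pi.single i 1 + Pi.single j 1 : Fin 3 → ℝ) k) ^ 2 = 2 := by
      fin_cases i <;> fin_cases j <;> simp [Fin.sum_univ_three] at * <;> norm_num
    rw [h1, h2] at h
    rw [abs_le]
    constructor <;> linarith [(hii i).1, (hii i).2, (hii j).1, (hii j).2, h.1, h.2]

theorem pow_mul_norm_A_le (H : AdmissibleCoefficients C T τ u Ab κb) {t : ℝ}
    (ht : t ∈ Icc (0:ℝ) T) (x : E3) (i j : Fin 3) {k : ℕ} (hk : 1 ≤ k) :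
    √(κb t x) ^ k * ‖iteratedFDeriv ℝ k (fun y => Ab t y i j) x‖ ≤
      C * √(κb t x) ^ 2 * √τ⁻¹ ^ k := by
  refine (mul_le_mul_of_nonneg_left ?_ (by positivity)).trans
    (sqrt_pow_mul_le_of_rpow_sub_two (H.κ_pos t x) (inv_pos.2 H.τ_pos) (H.deriv_A_κ k hk t ht x).1)
  let L : M3 →L[ℝ] ℝ := (ContinuousLinearMap.proj (R := ℝ) (φ := fun _ : Fin 3 => ℝ) j).comp
    (ContinuousLinearMap.proj (R := ℝ) (φ := fun _ : Fin 3 => Fin 3 → ℝ) i)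
  have hL : ‖L‖ ≤ 1 := L.opNorm_le_bound zero_le_one fun M => by
    rw [one_mul]
    exact (norm_le_pi_norm (M i) j).trans (norm_le_pi_norm M i)
  refine (L.norm_iteratedFDeriv_comp_left (H.smooth_A.slice t).contDiffAt
    (by exact_mod_cast le_top)).trans ?_
  exact mul_le_of_le_one_left (norm_nonneg _) hL

theorem pow_mul_norm_A_le' (H : AdmissibleCoefficients C T τ u Ab κb) {t : ℝ}
    (ht : t ∈ Icc (0:ℝ) T) (x : E3) (i j : Fin 3) (k : ℕ) :
    √(κb t x) ^ k * ‖iteratedFDeriv ℝ k (fun y => Ab t y i j) x‖ ≤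
      (C + 2) * √(κb t x) ^ 2 * √τ⁻¹ ^ k := by
  have hs : 0 ≤ √(κb t x) ^ 2 := by positivity
  rcases Nat.eq_zero_or_pos k with rfl | hk
  · have h := H.abs_A_apply_le ht x i j
    have := H.C_pos
    simp only [pow_zero, norm_iteratedFDeriv_zero, Real.norm_eq_abs, one_mul, mul_one]
    rw [Real.sq_sqrt (H.κ_pos t x).le] at *
    nlinarith
  · refine (H.pow_mul_norm_A_le ht x i j hk).trans ?_
    gcongr
    linarith

theorem pow_mul_norm_u_le (H : AdmissibleCoefficients C T τ u Ab κb) {t : ℝ}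
    (ht : t ∈ Icc (0:ℝ) T) (x : E3) (i : Fin 3) {k : ℕ} (hk : 1 ≤ k) :
    √(κb t x) ^ k * ‖iteratedFDeriv ℝ k (fun y => u t y i) x‖ ≤
      C * (√(κb t x) * √τ⁻¹) * √τ⁻¹ ^ k := by
  refine (mul_le_mul_of_nonneg_left ?_ (by positivity)).trans
    (sqrt_pow_mul_le_of_rpow_sub_one (H.κ_pos t x) (inv_pos.2 H.τ_pos) (H.deriv_u k hk t ht x))
  let L : E3 →L[ℝ] ℝ := EuclideanSpace.proj (𝕜 := ℝ) i
  have hL : ‖L‖ ≤ 1 := L.opNorm_le_bound zero_le_one fun M => by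
    rw [one_mul]
    exact PiLp.norm_apply_le M i
  refine (L.norm_iteratedFDeriv_comp_left (H.smooth_u.slice t).contDiffAt
    (by exact_mod_cast le_top)).trans ?_
  exact mul_le_of_le_one_left (norm_nonneg _) hL

theorem abs_spd_κ_le (H : AdmissibleCoefficients C T τ u Ab κb) {t : ℝ}
    (ht : t ∈ Icc (0:ℝ) T) (x : E3) (i : Fin 3) :
    |spd i (κb t) x| ≤ C * √(κb t x) * √τ⁻¹ := by
  have h := sqrt_pow_mul_le_of_rpow_sub_two (H.κ_pos t x) (inv_pos.2 H.τ_pos)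
    (H.deriv_A_κ 1 le_rfl t ht x).2
  have hs : 0 < √(κb t x) := Real.sqrt_pos.2 (H.κ_pos t x)
  have h1 : |spd i (κb t) x| ≤ ‖iteratedFDeriv ℝ 1 (κb t) x‖ := by
    rw [norm_iteratedFDeriv_one]
    have := (fderiv ℝ (κb t) x).le_opNorm (EuclideanSpace.single i (1 : ℝ))
    simpa [spd] using this
  refine h1.trans (le_of_mul_le_mul_left ?_ hs)
  linarith

end AdmissibleCoefficients

/-- The `i`-th component of `Ā∇ρ̄`. -/
def flux (Ab : ℝ → E3 → M3) (ρb : ℝ → E3 → ℝ) (i : Fin 3) (t : ℝ) (x : E3) : ℝ :=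
  ∑ j, Ab t x i j * spd j (ρb t) x

/-- The commutator of transport by `u` with the derivative along `I`. -/
def transportCommutator (u : ℝ → E3 → E3) (ρb : ℝ → E3 → ℝ) {n : ℕ} (I : Fin n → Fin 3)
    (t : ℝ) (x : E3) : ℝ :=
  ∑ i, (u t x i * spd i (wordDeriv I (ρb t)) x -
    wordDeriv I (fun y => u t y i * spd i (ρb t) y) x)

structure AdvectionDiffusion (T : ℝ) (u : ℝ → E3 → E3) (Ab : ℝ → E3 → M3)
    (ρb : ℝ → E3 → ℝ) : Prop where
  smooth_ρ : SmoothTS ρb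
  periodic_ρ : ∀ t, SpacePeriodic (ρb t)
  equation : ∀ t ∈ Icc (0:ℝ) T, ∀ x,
    deriv (fun s => ρb s x) t + ∑ i, u t x i * spd i (ρb t) x
      = ∑ i, spd i (fun y => ∑ j, Ab t y i j * spd j (ρb t) y) x

section Equation

variable {C T τ : ℝ} {u : ℝ → E3 → E3} {Ab : ℝ → E3 → M3} {κb ρb : ℝ → E3 → ℝ}

theorem smoothTS_flux (H : AdmissibleCoefficients C T τ u Ab κb) (hρ : SmoothTS ρb) (i : Fin 3) :
    SmoothTS (flux Ab ρb i) :=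
  SmoothTS.sum fun j => (H.smooth_A_apply i j).mul (hρ.spd j)

theorem matD_wordDeriv_eq (H : AdmissibleCoefficients C T τ u Ab κb)
    (hρ : AdvectionDiffusion T u Ab ρb) {t : ℝ} (ht : t ∈ Icc (0:ℝ) T) (x : E3) {n : ℕ}
    (I : Fin n → Fin 3) :
    matD u (fun s y => wordDeriv I (ρb s) y) t x =
      (∑ i, spd i (wordDeriv I (flux Ab ρb i t)) x) + transportCommutator u ρb I t x := by
  have hF := fun i => (smoothTS_flux H hρ.smooth_ρ i).slice t
  have hu := fun i => ((H.smooth_u_apply i).mul (hρ.smooth_ρ.spd i)).slice t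
  have e : (fun y => deriv (fun s => ρb s y) t) =
      fun y => (∑ i, spd i (flux Ab ρb i t) y) - ∑ i, u t y i * spd i (ρb t) y := by
    funext y
    exact eq_sub_of_add_eq (hρ.equation t ht y)
  unfold matD transportCommutator
  rw [hρ.smooth_ρ.deriv_wordDeriv, e, wordDeriv_sub (ContDiff.sum fun i _ => contDiff_spd (hF i) i)
    (ContDiff.sum fun i _ => hu i), wordDeriv_sum _ (fun i => contDiff_spd (hF i) i),
    wordDeriv_sum _ hu, Finset.sum_sub_distrib]
  simp only [wordDeriv_spd (hF _)]
  ring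

theorem deriv_energyDensity_add_div {κ φ : ℝ → E3 → ℝ} {G : Fin 3 → ℝ → E3 → ℝ}
    (hu : ∀ i, SmoothTS fun t x => u t x i) (hdiv : ∀ t x, divg (u t) x = 0)
    (hκ : SmoothTS κ) (hφ : SmoothTS φ) (hG : ∀ i, SmoothTS (G i)) (n : ℕ) (t : ℝ) (x : E3) :
    deriv (fun s => κ s x ^ n * φ s x ^ 2) t +
      ∑ i, spd i (fun y => u t y i * (κ t y ^ n * φ t y ^ 2) -
        2 * (κ t y ^ n * φ t y * G i t y)) x =
      n * κ t x ^ (n - 1) * matD u κ t x * φ t x ^ 2 +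
        2 * κ t x ^ n * φ t x * (matD u φ t x - ∑ i, spd i (G i t) x) -
        2 * ∑ i, (κ t x ^ n * spd i (φ t) x + n * κ t x ^ (n - 1) * spd i (κ t) x * φ t x) *
          G i t x := by
  have h1 : deriv (fun s => κ s x ^ n * φ s x ^ 2) t =
      n * κ t x ^ (n - 1) * deriv (fun s => κ s x) t * φ t x ^ 2 +
        κ t x ^ n * (2 * φ t x * deriv (fun s => φ s x) t) := by
    have := (((hκ.differentiableAt_time t x).hasDerivAt.pow n).mul
      ((hφ.differentiableAt_time t x).hasDerivAt.pow 2)).deriv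
    refine this.trans ?_
    simp
  have h2 : ∀ i, spd i (fun y => u t y i * (κ t y ^ n * φ t y ^ 2) -
        2 * (κ t y ^ n * φ t y * G i t y)) x =
      spd i (fun y => u t y i) x * (κ t x ^ n * φ t x ^ 2) +
      u t x i * (n * κ t x ^ (n - 1) * spd i (κ t) x * φ t x ^ 2 +
        κ t x ^ n * (2 * φ t x * spd i (φ t) x)) -
      2 * (κ t x ^ n * φ t x * spd i (G i t) x +
        (κ t x ^ n * spd i (φ t) x + n * κ t x ^ (n - 1) * spd i (κ t) x * φ t x) * G i t x) := by
    intro i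
    have dk := (hκ.pow n).differentiableAt t x
    have dp := (hφ.pow 2).differentiableAt t x
    have du := (hu i).differentiableAt t x
    have dkp := ((hκ.pow n).mul hφ).differentiableAt t x
    have dg := (hG i).differentiableAt t x
    rw [spd_sub (((hu i).mul ((hκ.pow n).mul (hφ.pow 2))).differentiableAt t x)
        (((((hκ.pow n).mul hφ).mul (hG i)).const_mul 2).differentiableAt t x),
      spd_mul du (((hκ.pow n).mul (hφ.pow 2)).differentiableAt t x), spd_mul dk dp,
      spd_const_mul ((((hκ.pow n).mul hφ).mul (hG i)).differentiableAt t x),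
      spd_mul dkp dg, spd_mul dk (hφ.differentiableAt t x),
      spd_pow (hκ.differentiableAt t x), spd_pow (hφ.differentiableAt t x)]
    simp
    ring
  have h3 := hdiv t x
  unfold divg at h3
  rw [h1]
  simp only [h2, matD]
  simp only [Fin.sum_univ_three] at *
  linear_combination (κ t x ^ n * φ t x ^ 2) * h3

end Equation

end Energy

section PointwiseEnergy

variable {C T τ : ℝ} {u : ℝ → E3 → E3} {Ab : ℝ → E3 → M3} {κb ρb : ℝ → E3 → ℝ}

theorem pow_mul_abs_transportCommutator_le (H : AdmissibleCoefficients C T τ u Ab κb)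
    (hρ : SmoothTS ρb) {t : ℝ} (ht : t ∈ Icc (0:ℝ) T) (x : E3) {n : ℕ} (I : Fin n → Fin 3) :
    √(κb t x) ^ n * |transportCommutator u ρb I t x| ≤
      3 * 2 ^ n * C * (√τ⁻¹ * (√τ⁻¹ * scaledJet √(κb t x) √τ⁻¹ n (ρb t) x)) := by
  have hσ : 0 < √(κb t x) := Real.sqrt_pos.2 (H.κ_pos t x)
  have hC := H.C_pos
  set σ := √(κb t x)
  set θ := √τ⁻¹
  have hθ : 0 ≤ θ := Real.sqrt_nonneg _
  have hi : ∀ i, σ ^ (n + 1) * |u t x i * spd i (wordDeriv I (ρb t)) x -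
      wordDeriv I (fun y => u t y i * spd i (ρb t) y) x| ≤
      2 ^ n * (C * (σ * θ) * (θ * scaledJet σ θ n (ρb t) x)) := by
    intro i
    rw [abs_sub_comm]
    exact pow_mul_commutator_le hσ.le hθ (by positivity) ((H.smooth_u_apply i).slice t)
      (hρ.slice t) (fun k hk => H.pow_mul_norm_u_le ht x i hk) i I
  have h : σ ^ (n + 1) * |transportCommutator u ρb I t x| ≤
      3 * (2 ^ n * (C * (σ * θ) * (θ * scaledJet σ θ n (ρb t) x))) := by
    refine (mul_le_mul_of_nonneg_left (Finset.abs_sum_le_sum_abs _ _) (by positivity)).trans ?_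
    rw [Finset.mul_sum]
    refine (Finset.sum_le_card_nsmul _ _ _ fun i _ => hi i).trans (le_of_eq ?_)
    simp
  refine le_of_mul_le_mul_left (a := σ) ?_ hσ
  calc _ = σ ^ (n + 1) * |transportCommutator u ρb I t x| := by ring
    _ ≤ _ := h
    _ = _ := by ring

theorem pow_mul_abs_flux_commutator_le (H : AdmissibleCoefficients C T τ u Ab κb)
    (hρ : SmoothTS ρb) {t : ℝ} (ht : t ∈ Icc (0:ℝ) T) (x : E3) {n : ℕ}
    (I : Fin (n + 1) → Fin 3) (i : Fin 3) :
    √(κb t x) ^ n * |wordDeriv I (flux Ab ρb i t) x -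
        ∑ j, Ab t x i j * spd j (wordDeriv I (ρb t)) x| ≤
      3 * 2 ^ (n + 1) * C * (√τ⁻¹ * scaledJet √(κb t x) √τ⁻¹ (n + 1) (ρb t) x) := by
  have hσ : 0 < √(κb t x) := Real.sqrt_pos.2 (H.κ_pos t x)
  have hC := H.C_pos
  set σ := √(κb t x)
  set θ := √τ⁻¹
  have hθ : 0 ≤ θ := Real.sqrt_nonneg _
  have hj : ∀ j, σ ^ (n + 1 + 1) * |wordDeriv I (fun y => Ab t y i j * spd j (ρb t) y) x -
      Ab t x i j * spd j (wordDeriv I (ρb t)) x| ≤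
      2 ^ (n + 1) * (C * σ ^ 2 * (θ * scaledJet σ θ (n + 1) (ρb t) x)) := fun j =>
    pow_mul_commutator_le hσ.le hθ (by positivity) ((H.smooth_A_apply i j).slice t)
      (hρ.slice t) (fun k hk => H.pow_mul_norm_A_le ht x i j hk) j I
  have h : σ ^ (n + 1 + 1) * |wordDeriv I (flux Ab ρb i t) x -
        ∑ j, Ab t x i j * spd j (wordDeriv I (ρb t)) x| ≤
      3 * (2 ^ (n + 1) * (C * σ ^ 2 * (θ * scaledJet σ θ (n + 1) (ρb t) x))) := by
    have e : wordDeriv I (flux Ab ρb i t) x =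
        ∑ j, wordDeriv I (fun y => Ab t y i j * spd j (ρb t) y) x :=
      wordDeriv_sum _ (fun j => ((H.smooth_A_apply i j).mul (hρ.spd j)).slice t) I x
    rw [e, ← Finset.sum_sub_distrib]
    refine (mul_le_mul_of_nonneg_left (Finset.abs_sum_le_sum_abs _ _) (by positivity)).trans ?_
    rw [Finset.mul_sum]
    refine (Finset.sum_le_card_nsmul _ _ _ fun j _ => hj j).trans (le_of_eq ?_)
    simp
  refine le_of_mul_le_mul_left (a := σ ^ 2) ?_ (by positivity)
  calc _ = σ ^ (n + 1 + 1) * |wordDeriv I (flux Ab ρb i t) x -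
        ∑ j, Ab t x i j * spd j (wordDeriv I (ρb t)) x| := by ring
    _ ≤ _ := h
    _ = _ := by ring

/-- The weighted density `κ̄ᵏ|∇ᵏρ̄|²`, with the Hilbert–Schmidt norm of the derivative tensor. -/
def energyDensity (κb ρb : ℝ → E3 → ℝ) (k : ℕ) (t : ℝ) (x : E3) : ℝ :=
  κb t x ^ k * ∑ I : Fin k → Fin 3, wordDeriv I (ρb t) x ^ 2

theorem smoothTS_energyDensity (hκ : SmoothTS κb) (hρ : SmoothTS ρb) (k : ℕ) :
    SmoothTS (energyDensity κb ρb k) :=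
  (hκ.pow k).mul (SmoothTS.sum fun I => (hρ.wordDeriv I).pow 2)

/-- The vector field whose divergence enters the local energy balance. -/
def energyFlux (u : ℝ → E3 → E3) (Ab : ℝ → E3 → M3) (κb ρb : ℝ → E3 → ℝ) {n : ℕ}
    (I : Fin n → Fin 3) (i : Fin 3) (t : ℝ) (x : E3) : ℝ :=
  u t x i * (κb t x ^ n * wordDeriv I (ρb t) x ^ 2) -
    2 * (κb t x ^ n * wordDeriv I (ρb t) x * wordDeriv I (flux Ab ρb i t) x)

theorem exists_local_energy_inequality (C : ℝ) (n : ℕ) : ∃ c : ℝ, 0 ≤ c ∧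
    ∀ {T τ : ℝ} {u : ℝ → E3 → E3} {Ab : ℝ → E3 → M3} {κb ρb : ℝ → E3 → ℝ},
      AdmissibleCoefficients C T τ u Ab κb → AdvectionDiffusion T u Ab ρb →
      ∀ t ∈ Icc (0:ℝ) T, ∀ (x : E3) (I : Fin (n + 1) → Fin 3),
        deriv (fun s => κb s x ^ (n + 1) * wordDeriv I (ρb s) x ^ 2) t +
            ∑ i, spd i (energyFlux u Ab κb ρb I i t) x ≤
          -(1 / 2) * (κb t x ^ (n + 2) * ∑ i, spd i (wordDeriv I (ρb t)) x ^ 2) +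
            c * ∑ k ∈ Finset.Icc 1 (n + 1), τ⁻¹ ^ (n + 2 - k) * energyDensity κb ρb k t x := by
  rcases le_or_gt C 0 with hC0 | hC0
  · exact ⟨0, le_rfl, fun H => absurd H.C_pos (not_lt.2 hC0)⟩
  set c₀ : ℝ := 3 * 2 ^ (n + 1) * C with hc₀
  set N : ℝ := ((n + 1 : ℕ) : ℝ) with hN
  have hc₀0 : 0 ≤ c₀ := by positivity
  have hN0 : 0 ≤ N := Nat.cast_nonneg _
  set c₁ : ℝ := N * C + 2 * c₀ + 24 * c₀ ^ 2 + 864 * N ^ 2 * C ^ 2 + 6 * N * C * c₀ with hc₁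
  have hc₁0 : 0 ≤ c₁ := by positivity
  refine ⟨c₁ * (N * ((3 : ℕ) + 1 : ℝ) ^ (n + 1)), by positivity, ?_⟩
  intro T τ u Ab κb ρb H hρ t ht x I
  have hκ := H.κ_pos t x
  have hτ : 0 < τ⁻¹ := inv_pos.2 H.τ_pos
  have hσ : 0 < √(κb t x) := Real.sqrt_pos.2 hκ
  have hθ : 0 ≤ √τ⁻¹ := Real.sqrt_nonneg _
  have hM := scaledJet_nonneg hσ.le hθ (n + 1) (ρb t) x
  have hR := pow_mul_abs_transportCommutator_le H hρ.smooth_ρ ht x I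
  have hK := pow_mul_abs_flux_commutator_le H hρ.smooth_ρ ht x I
  have hδ := H.abs_spd_κ_le ht x
  have hA := H.abs_A_apply_le ht x
  have hβ := H.matD_κ t ht x
  have hell := (H.elliptic t ht x fun i => √(κb t x) ^ n * spd i (wordDeriv I (ρb t)) x).1
  have hJ := sq_scaledJet_le hκ.le hτ.le (n + 1) (ρb t) x
  have hbal := deriv_energyDensity_add_div H.smooth_u_apply H.div_u H.smooth_κ
    (hρ.smooth_ρ.wordDeriv I) (fun i => (smoothTS_flux H hρ.smooth_ρ i).wordDeriv I) (n + 1) t x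
  rw [matD_wordDeriv_eq H hρ ht x I, add_sub_cancel_left] at hbal
  have ha : √(κb t x) ^ (n + 1) * |wordDeriv I (ρb t) x| ≤
      scaledJet √(κb t x) √τ⁻¹ (n + 1) (ρb t) x := by
    refine (mul_le_mul_of_nonneg_left (abs_wordDeriv_le I (ρb t) x) (by positivity)).trans ?_
    simpa using le_scaledJet hσ.le hθ (Nat.succ_pos n) le_rfl (ρb t) x
  have hsq : √(κb t x) ^ 2 = κb t x := Real.sq_sqrt hκ.le
  have hsq' : √τ⁻¹ ^ 2 = τ⁻¹ := Real.sq_sqrt hτ.le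
  set σ := √(κb t x)
  set θ := √τ⁻¹
  set M := scaledJet σ θ (n + 1) (ρb t) x
  set φ := wordDeriv I (ρb t) x
  set R := transportCommutator u ρb I t x
  set G : Fin 3 → ℝ := fun i => wordDeriv I (flux Ab ρb i t) x with hG
  set p : Fin 3 → ℝ := fun i => spd i (wordDeriv I (ρb t)) x with hp
  set K : Fin 3 → ℝ := fun i => G i - ∑ j, Ab t x i j * p j with hKdef
  have hmain := scaled_dissipation_le (N := N) (C := C) (c := c₀) (w := θ * M)
    (a := σ ^ (n + 1) * φ) (R := σ ^ (n + 1) * R) (β := matD u κb t x / σ ^ 2)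
    (q := fun i => σ ^ (n + 2) * p i) (k := fun i => σ ^ n * K i)
    (δ := fun i => spd i (κb t) x / σ) (A := fun i j => Ab t x i j / σ ^ 2)
    hN0 hC0.le hθ hM rfl
    (by rwa [abs_mul, abs_of_nonneg (by positivity)])
    (by rwa [abs_mul, abs_of_nonneg (by positivity)])
    (by rw [abs_div, abs_of_nonneg (by positivity : 0 ≤ σ ^ 2), div_le_iff₀ (by positivity), hsq,
          hsq']; exact hβ)
    (fun i => by rw [abs_mul, abs_of_nonneg (by positivity : 0 ≤ σ ^ n)]; exact hK i)
    (fun i => by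
      rw [abs_div, abs_of_nonneg hσ.le, div_le_iff₀ hσ]
      exact (hδ i).trans_eq (by ring))
    (fun i j => by
      rw [abs_div, abs_of_nonneg (by positivity : 0 ≤ σ ^ 2), div_le_iff₀ (by positivity), hsq]
      exact hA i j)
    (by
      have e1 : ∑ i, (σ ^ (n + 2) * p i) ^ 2 = σ ^ 2 * (σ ^ 2 * ∑ i, (σ ^ n * p i) ^ 2) := by
        simp only [Fin.sum_univ_three]; ring
      have e2 : ∑ i, ∑ j, Ab t x i j / σ ^ 2 * (σ ^ (n + 2) * p i) * (σ ^ (n + 2) * p j) =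
          σ ^ 2 * qf (Ab t x) (fun i => σ ^ n * p i) (fun i => σ ^ n * p i) := by
        simp only [qf, Fin.sum_univ_three]
        field_simp
        ring
      rw [e1, e2]
      rw [← hsq] at hell
      nlinarith [sq_nonneg σ])
  have hGK : ∀ i, G i = (∑ j, Ab t x i j * p j) + K i := fun i => by rw [hKdef]; ring
  have hid : N * (matD u κb t x / σ ^ 2) * (σ ^ (n + 1) * φ) ^ 2 +
      2 * (σ ^ (n + 1) * φ) * (σ ^ (n + 1) * R) -
      2 * ∑ i, (σ ^ (n + 2) * p i + N * (spd i (κb t) x / σ) * (σ ^ (n + 1) * φ)) *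
        (∑ j, Ab t x i j / σ ^ 2 * (σ ^ (n + 2) * p j) + σ ^ n * K i) =
      N * κb t x ^ n * matD u κb t x * φ ^ 2 + 2 * κb t x ^ (n + 1) * φ * R -
        2 * ∑ i, (κb t x ^ (n + 1) * p i + N * κb t x ^ n * spd i (κb t) x * φ) * G i := by
    have e1 : ∀ i, (σ ^ (n + 2) * p i + N * (spd i (κb t) x / σ) * (σ ^ (n + 1) * φ)) *
        (∑ j, Ab t x i j / σ ^ 2 * (σ ^ (n + 2) * p j) + σ ^ n * K i) =
        (κb t x ^ (n + 1) * p i + N * κb t x ^ n * spd i (κb t) x * φ) * G i := by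
      intro i
      rw [hGK, ← hsq]
      simp only [Fin.sum_univ_three]
      field_simp
      ring
    rw [Finset.sum_congr rfl fun i _ => e1 i, ← hsq]
    field_simp
    ring
  rw [hid] at hmain
  have hq : ∑ i, (σ ^ (n + 2) * p i) ^ 2 = κb t x ^ (n + 2) * ∑ i, p i ^ 2 := by
    rw [← hsq]
    simp only [Fin.sum_univ_three]
    ring
  rw [hq] at hmain
  have hJ' : (θ * M) ^ 2 ≤ N * ((3 : ℕ) + 1 : ℝ) ^ (n + 1) *
      ∑ k ∈ Finset.Icc 1 (n + 1), τ⁻¹ ^ (n + 2 - k) * energyDensity κb ρb k t x := by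
    have e : ∑ k ∈ Finset.Icc 1 (n + 1), τ⁻¹ ^ (n + 2 - k) * energyDensity κb ρb k t x =
        τ⁻¹ * ∑ k ∈ Finset.Icc 1 (n + 1), τ⁻¹ ^ (n + 1 - k) *
          (κb t x ^ k * ∑ I : Fin k → Fin 3, wordDeriv I (ρb t) x ^ 2) := by
      rw [Finset.mul_sum]
      refine Finset.sum_congr rfl fun k hk => ?_
      have := (Finset.mem_Icc.1 hk).2
      rw [show n + 2 - k = (n + 1 - k) + 1 by omega, pow_succ]
      unfold energyDensity
      ring
    rw [mul_pow, hsq', e]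
    exact (mul_le_mul_of_nonneg_left hJ hτ.le).trans_eq (by ring)
  refine (hbal.trans_le hmain).trans ?_
  rw [mul_assoc c₁]
  exact add_le_add le_rfl (mul_le_mul_of_nonneg_left hJ' hc₁0)

theorem exists_local_matD_bound (C : ℝ) (n : ℕ) : ∃ c : ℝ, 0 ≤ c ∧
    ∀ {T τ : ℝ} {u : ℝ → E3 → E3} {Ab : ℝ → E3 → M3} {κb ρb : ℝ → E3 → ℝ},
      AdmissibleCoefficients C T τ u Ab κb → AdvectionDiffusion T u Ab ρb →
      ∀ t ∈ Icc (0:ℝ) T, ∀ (x : E3) (I : Fin n → Fin 3),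
        κb t x ^ n * matD u (fun s y => wordDeriv I (ρb s) y) t x ^ 2 ≤
          c * ∑ k ∈ Finset.Icc 1 (n + 2), τ⁻¹ ^ (n + 2 - k) * energyDensity κb ρb k t x := by
  rcases le_or_gt C 0 with hC0 | hC0
  · exact ⟨0, le_rfl, fun H => absurd H.C_pos (not_lt.2 hC0)⟩
  set c₀ : ℝ := 9 * 2 ^ (n + 1) * (C + 2) + 3 * 2 ^ n * C with hc₀
  have hc₀0 : 0 ≤ c₀ := by positivity
  refine ⟨c₀ ^ 2 * ((n + 2 : ℕ) * ((3 : ℕ) + 1 : ℝ) ^ (n + 2)), by positivity, ?_⟩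
  intro T τ u Ab κb ρb H hρ t ht x I
  have hκ := H.κ_pos t x
  have hτ : 0 < τ⁻¹ := inv_pos.2 H.τ_pos
  have hσ : 0 < √(κb t x) := Real.sqrt_pos.2 hκ
  have hθ : 0 ≤ √τ⁻¹ := Real.sqrt_nonneg _
  have hR := pow_mul_abs_transportCommutator_le H hρ.smooth_ρ ht x I
  have hJ := sq_scaledJet_le hκ.le hτ.le (n + 2) (ρb t) x
  have hAD := H.pow_mul_norm_A_le' ht x
  have hsq : √(κb t x) ^ 2 = κb t x := Real.sq_sqrt hκ.le
  rw [matD_wordDeriv_eq H hρ ht x I]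
  set σ := √(κb t x)
  set θ := √τ⁻¹
  have hM1 : θ * (θ * scaledJet σ θ n (ρb t) x) ≤ scaledJet σ θ (n + 2) (ρb t) x := by
    rw [scaledJet_succ, scaledJet_succ, mul_add]
    have h1 : 0 ≤ θ * (σ ^ (n + 1) * ‖iteratedFDeriv ℝ (n + 1) (ρb t) x‖) := by positivity
    have h2 : 0 ≤ σ ^ (n + 2) * ‖iteratedFDeriv ℝ (n + 2) (ρb t) x‖ := by positivity
    linarith
  have hM := scaledJet_nonneg hσ.le hθ (n + 2) (ρb t) x
  set M := scaledJet σ θ (n + 2) (ρb t) x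
  have hF : ∀ i, σ ^ n * |spd i (wordDeriv I (flux Ab ρb i t)) x| ≤
      3 * 2 ^ (n + 1) * (C + 2) * M := by
    intro i
    have hFs := (smoothTS_flux H hρ.smooth_ρ i).slice t
    have hs := fun j => ((H.smooth_A_apply i j).mul (hρ.smooth_ρ.spd j)).slice t
    rw [← wordDeriv_cons hFs]
    have e : wordDeriv (Fin.cons i I : Fin (n + 1) → Fin 3) (flux Ab ρb i t) x =
        ∑ j, wordDeriv (Fin.cons i I : Fin (n + 1) → Fin 3)
          (fun y => Ab t y i j * spd j (ρb t) y) x := wordDeriv_sum _ hs _ x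
    have hj : ∀ j, σ ^ (n + 2) * |wordDeriv (Fin.cons i I : Fin (n + 1) → Fin 3)
          (fun y => Ab t y i j * spd j (ρb t) y) x| ≤ 2 ^ (n + 1) * ((C + 2) * σ ^ 2 * M) :=
      fun j => (mul_le_mul_of_nonneg_left (abs_wordDeriv_le _ _ _) (by positivity)).trans
        (pow_mul_norm_iteratedFDeriv_mul_spd_le hσ.le hθ (by positivity) (n + 1)
          ((H.smooth_A_apply i j).slice t) (hρ.smooth_ρ.slice t) (hAD i j) j)
    refine le_of_mul_le_mul_left (a := σ ^ 2) ?_ (by positivity)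
    rw [e]
    calc _ = σ ^ (n + 2) * |∑ j, wordDeriv (Fin.cons i I : Fin (n + 1) → Fin 3)
          (fun y => Ab t y i j * spd j (ρb t) y) x| := by ring
      _ ≤ ∑ j, σ ^ (n + 2) * |wordDeriv (Fin.cons i I : Fin (n + 1) → Fin 3)
          (fun y => Ab t y i j * spd j (ρb t) y) x| := by
        rw [← Finset.mul_sum]
        exact mul_le_mul_of_nonneg_left (Finset.abs_sum_le_sum_abs _ _) (by positivity)
      _ ≤ 3 * (2 ^ (n + 1) * ((C + 2) * σ ^ 2 * M)) :=
        (Finset.sum_le_card_nsmul _ _ _ fun j _ => hj j).trans (le_of_eq (by simp))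
      _ = _ := by ring
  have htot : σ ^ n * |(∑ i, spd i (wordDeriv I (flux Ab ρb i t)) x) +
      transportCommutator u ρb I t x| ≤ c₀ * M := by
    calc _ ≤ σ ^ n * ((∑ i, |spd i (wordDeriv I (flux Ab ρb i t)) x|) +
          |transportCommutator u ρb I t x|) := by
          gcongr
          exact (abs_add_le _ _).trans (add_le_add (Finset.abs_sum_le_sum_abs _ _) le_rfl)
      _ = (∑ i, σ ^ n * |spd i (wordDeriv I (flux Ab ρb i t)) x|) +
          σ ^ n * |transportCommutator u ρb I t x| := by rw [mul_add, Finset.mul_sum]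
      _ ≤ 3 * (3 * 2 ^ (n + 1) * (C + 2) * M) + 3 * 2 ^ n * C * M := by
          refine add_le_add ?_ (hR.trans (mul_le_mul_of_nonneg_left hM1 (by positivity)))
          exact (Finset.sum_le_card_nsmul _ _ _ fun j _ => hF j).trans (le_of_eq (by simp))
      _ = _ := by rw [hc₀]; ring
  have hκn : κb t x ^ n = (σ ^ n) ^ 2 := by rw [← hsq]; ring
  rw [hκn, ← mul_pow, ← sq_abs, abs_mul, abs_of_nonneg (by positivity : 0 ≤ σ ^ n)]
  refine (pow_le_pow_left₀ (by positivity) htot 2).trans ?_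
  rw [mul_pow, mul_assoc (c₀ ^ 2)]
  exact mul_le_mul_of_nonneg_left hJ (by positivity)

end PointwiseEnergy

section IntegratedEnergy

/-- The squared weighted norm `‖κ̄^{k/2}∇ᵏρ̄(t)‖²_{L²}`, for the Hilbert–Schmidt tensor norm. -/
def weightedEnergy (κb ρb : ℝ → E3 → ℝ) (k : ℕ) (t : ℝ) : ℝ :=
  ∫ x in cube 3, energyDensity κb ρb k t x

/-- The controlling quantity `τ^{-n}D̄ + ∑_{i=1}^n τ^{-(n-i)} ‖(κ̄^{i/2}∇ⁱρ̄)(0)‖²_{L²}`. -/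
def energyBound (T τ : ℝ) (κb ρb : ℝ → E3 → ℝ) (n : ℕ) : ℝ :=
  τ⁻¹ ^ n * (∫ s in (0:ℝ)..T, weightedEnergy κb ρb 1 s) +
    ∑ i ∈ Finset.Icc 1 n, τ⁻¹ ^ (n - i) * weightedEnergy κb ρb i 0

variable {C T τ : ℝ} {u : ℝ → E3 → E3} {Ab : ℝ → E3 → M3} {κb ρb : ℝ → E3 → ℝ}

theorem energyDensity_nonneg (hκ : ∀ t x, 0 < κb t x) (k : ℕ) (t : ℝ) (x : E3) :
    0 ≤ energyDensity κb ρb k t x :=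
  mul_nonneg (pow_nonneg (hκ t x).le _) (Finset.sum_nonneg fun _ _ => sq_nonneg _)

theorem weightedEnergy_nonneg (hκ : ∀ t x, 0 < κb t x) (k : ℕ) (t : ℝ) :
    0 ≤ weightedEnergy κb ρb k t :=
  integral_nonneg fun x => energyDensity_nonneg hκ k t x

theorem continuous_weightedEnergy (hκ : SmoothTS κb) (hρ : SmoothTS ρb) (k : ℕ) :
    Continuous (weightedEnergy κb ρb k) :=
  continuous_integral_cube (smoothTS_energyDensity hκ hρ k).continuous

theorem integrableOn_energyDensity (hκ : SmoothTS κb) (hρ : SmoothTS ρb) (k : ℕ) (t : ℝ) :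
    IntegrableOn (energyDensity κb ρb k t) (cube 3) :=
  integrableOn_cube ((smoothTS_energyDensity hκ hρ k).slice t).continuous

theorem integral_sum_mul_energyDensity (hκ : SmoothTS κb) (hρ : SmoothTS ρb) (s : Finset ℕ)
    (a : ℕ → ℝ) (t : ℝ) :
    ∫ x in cube 3, ∑ k ∈ s, a k * energyDensity κb ρb k t x =
      ∑ k ∈ s, a k * weightedEnergy κb ρb k t := by
  rw [integral_finsetSum _ fun k _ => (integrableOn_energyDensity hκ hρ k t).const_mul _]
  simp only [integral_const_mul, weightedEnergy]

theorem AdmissibleCoefficients.periodic_flux (H : AdmissibleCoefficients C T τ u Ab κb)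
    (hρ : ∀ t, SpacePeriodic (ρb t)) (i : Fin 3) (t : ℝ) : SpacePeriodic (flux Ab ρb i t) := by
  intro x m
  unfold flux
  rw [H.periodic_A t x m]
  exact Finset.sum_congr rfl fun j _ => by rw [(hρ t).spd j x m]

theorem smoothTS_energyFlux (H : AdmissibleCoefficients C T τ u Ab κb) (hρ : SmoothTS ρb)
    {n : ℕ} (I : Fin n → Fin 3) (i : Fin 3) : SmoothTS (energyFlux u Ab κb ρb I i) :=
  ((H.smooth_u_apply i).mul ((H.smooth_κ.pow n).mul ((hρ.wordDeriv I).pow 2))).sub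
    ((((H.smooth_κ.pow n).mul (hρ.wordDeriv I)).mul
      ((smoothTS_flux H hρ i).wordDeriv I)).const_mul 2)

theorem periodic_energyFlux (H : AdmissibleCoefficients C T τ u Ab κb)
    (hρ : AdvectionDiffusion T u Ab ρb) {n : ℕ} (I : Fin n → Fin 3) (i : Fin 3) (t : ℝ) :
    SpacePeriodic (energyFlux u Ab κb ρb I i t) := by
  intro x m
  unfold energyFlux
  rw [H.periodic_u t x m, H.periodic_κ t x m,
    (hρ.periodic_ρ t).wordDeriv (hρ.smooth_ρ.slice t) I x m,
    (H.periodic_flux hρ.periodic_ρ i t).wordDeriv ((smoothTS_flux H hρ.smooth_ρ i).slice t) I x m]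

theorem exists_weightedEnergy_dissipation (C : ℝ) (n : ℕ) : ∃ c : ℝ, 0 ≤ c ∧
    ∀ {T τ : ℝ} {u : ℝ → E3 → E3} {Ab : ℝ → E3 → M3} {κb ρb : ℝ → E3 → ℝ},
      AdmissibleCoefficients C T τ u Ab κb → AdvectionDiffusion T u Ab ρb →
      ∀ t ∈ Icc (0:ℝ) T,
        ∫ x in cube 3, deriv (fun s => energyDensity κb ρb (n + 1) s x) t ≤
          -(1 / 2) * weightedEnergy κb ρb (n + 2) t +
            c * ∑ k ∈ Finset.Icc 1 (n + 1), τ⁻¹ ^ (n + 2 - k) * weightedEnergy κb ρb k t := by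
  obtain ⟨c, hc, h⟩ := exists_local_energy_inequality C n
  refine ⟨3 ^ (n + 1) * c, by positivity, ?_⟩
  intro T τ u Ab κb ρb H hρ t ht
  have hloc := h H hρ t ht
  set r := τ⁻¹
  set S : E3 → ℝ := fun x =>
    ∑ k ∈ Finset.Icc 1 (n + 1), r ^ (n + 2 - k) * energyDensity κb ρb k t x with hS
  have hSi : IntegrableOn S (cube 3) := integrable_finsetSum _ fun k _ =>
    (integrableOn_energyDensity H.smooth_κ hρ.smooth_ρ k t).const_mul _
  have hEi := integrableOn_energyDensity H.smooth_κ hρ.smooth_ρ (n + 2) t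
  have hdiv : ∀ (I : Fin (n + 1) → Fin 3) i,
      IntegrableOn (spd i (energyFlux u Ab κb ρb I i t)) (cube 3) := fun I i =>
    integrableOn_cube (((smoothTS_energyFlux H hρ.smooth_ρ I i).spd i).slice t).continuous
  have hdivsum : IntegrableOn (fun x => ∑ I : Fin (n + 1) → Fin 3, ∑ i,
      spd i (energyFlux u Ab κb ρb I i t) x) (cube 3) :=
    integrable_finsetSum _ fun I _ => integrable_finsetSum _ fun i _ => hdiv I i
  have hdiv0 : ∫ x in cube 3, ∑ I : Fin (n + 1) → Fin 3, ∑ i,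
      spd i (energyFlux u Ab κb ρb I i t) x = 0 := by
    rw [integral_finsetSum _ fun I _ => integrable_finsetSum _ fun i _ => hdiv I i]
    refine Finset.sum_eq_zero fun I _ => ?_
    rw [integral_finsetSum _ fun i _ => hdiv I i]
    exact Finset.sum_eq_zero fun i _ => integral_cube_spd_eq_zero
      ((smoothTS_energyFlux H hρ.smooth_ρ I i).slice t) (periodic_energyFlux H hρ I i t) i
  have hpt : ∀ x, deriv (fun s => energyDensity κb ρb (n + 1) s x) t ≤
      (-(1 / 2) * energyDensity κb ρb (n + 2) t x + 3 ^ (n + 1) * c * S x) -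
        ∑ I : Fin (n + 1) → Fin 3, ∑ i, spd i (energyFlux u Ab κb ρb I i t) x := by
    intro x
    have hder : deriv (fun s => energyDensity κb ρb (n + 1) s x) t =
        ∑ I : Fin (n + 1) → Fin 3,
          deriv (fun s => κb s x ^ (n + 1) * wordDeriv I (ρb s) x ^ 2) t := by
      simp only [energyDensity, Finset.mul_sum]
      exact deriv_fun_sum fun I _ => ((H.smooth_κ.pow (n + 1)).mul
        ((hρ.smooth_ρ.wordDeriv I).pow 2)).differentiableAt_time t x
    have hsum := Finset.sum_le_sum fun (I : Fin (n + 1) → Fin 3) (_ : I ∈ Finset.univ) => hloc x I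
    rw [Finset.sum_add_distrib, Finset.sum_add_distrib, ← hder, ← Finset.mul_sum,
      ← Finset.mul_sum, ← sum_sq_wordDeriv_succ (hρ.smooth_ρ.slice t)] at hsum
    simp only [Finset.sum_const, Finset.card_univ, Fintype.card_fun, Fintype.card_fin,
      nsmul_eq_mul, Nat.cast_pow, Nat.cast_ofNat, ← mul_assoc] at hsum
    simp only [hS, energyDensity, ← mul_assoc] at hsum ⊢
    linarith
  have hdi := integrableOn_cube
    (((smoothTS_energyDensity H.smooth_κ hρ.smooth_ρ (n + 1)).timeDeriv).slice t).continuous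
  have hm1 := hEi.const_mul (-(1 / 2))
  have hm2 := hSi.const_mul (3 ^ (n + 1) * c)
  refine (integral_mono hdi ((hm1.add hm2).sub hdivsum) hpt).trans (le_of_eq ?_)
  have e := integral_sub (hm1.add hm2) hdivsum
  simp only [Pi.add_apply] at e
  rw [Pi.add_def, Pi.sub_def, e, hdiv0, sub_zero, integral_add hm1 hm2, integral_const_mul,
    integral_const_mul, integral_sum_mul_energyDensity H.smooth_κ hρ.smooth_ρ]
  rfl

theorem exists_weightedEnergy_inequality (C : ℝ) (n : ℕ) : ∃ c : ℝ, 0 ≤ c ∧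
    ∀ {T τ : ℝ} {u : ℝ → E3 → E3} {Ab : ℝ → E3 → M3} {κb ρb : ℝ → E3 → ℝ},
      AdmissibleCoefficients C T τ u Ab κb → AdvectionDiffusion T u Ab ρb →
      ∀ t ∈ Icc (0:ℝ) T,
        weightedEnergy κb ρb (n + 1) t +
            1 / 2 * ∫ s in (0:ℝ)..t, weightedEnergy κb ρb (n + 2) s ≤
          weightedEnergy κb ρb (n + 1) 0 + c * ∑ k ∈ Finset.Icc 1 (n + 1),
            τ⁻¹ ^ (n + 2 - k) * ∫ s in (0:ℝ)..T, weightedEnergy κb ρb k s := by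
  obtain ⟨c, hc, h⟩ := exists_weightedEnergy_dissipation C n
  refine ⟨c, hc, ?_⟩
  intro T τ u Ab κb ρb H hρ t ht
  have hr : 0 < τ⁻¹ := inv_pos.2 H.τ_pos
  have hcont := continuous_weightedEnergy H.smooth_κ hρ.smooth_ρ
  have hint := fun k a b => (hcont k).intervalIntegrable (μ := volume) a b
  have hftc := integral_cube_sub_eq (smoothTS_energyDensity H.smooth_κ hρ.smooth_ρ (n + 1)) 0 t
  have hmono := intervalIntegral.integral_mono_on ht.1
    ((continuous_integral_cube (smoothTS_energyDensity H.smooth_κ hρ.smooth_ρ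
      (n + 1)).timeDeriv.continuous).intervalIntegrable 0 t)
    (((hint (n + 2) 0 t).const_mul (-(1 / 2))).add ((IntervalIntegrable.sum _
      fun k (_ : k ∈ Finset.Icc 1 (n + 1)) =>
        (hint k 0 t).const_mul (τ⁻¹ ^ (n + 2 - k))).const_mul c))
    (fun s hs => by
      simpa only [Finset.sum_apply] using h H hρ s ⟨hs.1, hs.2.trans ht.2⟩)
  rw [← hftc, intervalIntegral.integral_add ((hint (n + 2) 0 t).const_mul _)
    ((IntervalIntegrable.sum _ fun k _ => (hint k 0 t).const_mul _).const_mul c),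
    intervalIntegral.integral_const_mul, intervalIntegral.integral_const_mul] at hmono
  simp only [Finset.sum_apply] at hmono
  rw [intervalIntegral.integral_finsetSum fun k _ => (hint k 0 t).const_mul _] at hmono
  simp only [intervalIntegral.integral_const_mul] at hmono
  have hle : ∑ k ∈ Finset.Icc 1 (n + 1),
        τ⁻¹ ^ (n + 2 - k) * ∫ s in (0:ℝ)..t, weightedEnergy κb ρb k s ≤
      ∑ k ∈ Finset.Icc 1 (n + 1),
        τ⁻¹ ^ (n + 2 - k) * ∫ s in (0:ℝ)..T, weightedEnergy κb ρb k s :=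
    Finset.sum_le_sum fun k _ => mul_le_mul_of_nonneg_left
      (intervalIntegral.integral_mono_interval le_rfl ht.1 ht.2
        (Eventually.of_forall fun s => weightedEnergy_nonneg H.κ_pos k s) (hint k 0 T))
      (by positivity)
  have := mul_le_mul_of_nonneg_left hle hc
  change weightedEnergy κb ρb (n + 1) t - weightedEnergy κb ρb (n + 1) 0 ≤ _ at hmono
  linarith

theorem integral_weightedEnergy_nonneg (H : AdmissibleCoefficients C T τ u Ab κb) (k : ℕ) :
    0 ≤ ∫ s in (0:ℝ)..T, weightedEnergy κb ρb k s :=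
  intervalIntegral.integral_nonneg H.T_pos.le fun s _ => weightedEnergy_nonneg H.κ_pos k s

theorem energyBound_nonneg (H : AdmissibleCoefficients C T τ u Ab κb) (n : ℕ) :
    0 ≤ energyBound T τ κb ρb n := by
  have hr : 0 < τ⁻¹ := inv_pos.2 H.τ_pos
  exact add_nonneg (mul_nonneg (by positivity) (integral_weightedEnergy_nonneg H 1))
    (Finset.sum_nonneg fun i _ => mul_nonneg (by positivity) (weightedEnergy_nonneg H.κ_pos i 0))

theorem pow_mul_energyBound_le (H : AdmissibleCoefficients C T τ u Ab κb) {k n : ℕ}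
    (hkn : k ≤ n) :
    τ⁻¹ ^ (n - k) * energyBound T τ κb ρb k ≤ energyBound T τ κb ρb n := by
  have hr : 0 < τ⁻¹ := inv_pos.2 H.τ_pos
  unfold energyBound
  rw [mul_add, ← mul_assoc, ← pow_add, Nat.sub_add_cancel hkn, Finset.mul_sum]
  refine add_le_add le_rfl ?_
  calc _ = ∑ i ∈ Finset.Icc 1 k, τ⁻¹ ^ (n - i) * weightedEnergy κb ρb i 0 := by
        refine Finset.sum_congr rfl fun i hi => ?_
        have := (Finset.mem_Icc.1 hi).2
        rw [← mul_assoc, ← pow_add, show n - k + (k - i) = n - i by omega]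
    _ ≤ _ := Finset.sum_le_sum_of_subset_of_nonneg (Finset.Icc_subset_Icc le_rfl hkn)
        fun i _ _ => mul_nonneg (by positivity) (weightedEnergy_nonneg H.κ_pos i 0)

theorem weightedEnergy_zero_le_energyBound (H : AdmissibleCoefficients C T τ u Ab κb) {n : ℕ}
    (hn : 1 ≤ n) : weightedEnergy κb ρb n 0 ≤ energyBound T τ κb ρb n := by
  have hr : 0 < τ⁻¹ := inv_pos.2 H.τ_pos
  have h := Finset.single_le_sum (f := fun i => τ⁻¹ ^ (n - i) * weightedEnergy κb ρb i 0)
    (fun i _ => mul_nonneg (by positivity) (weightedEnergy_nonneg H.κ_pos i 0))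
    (Finset.mem_Icc.2 ⟨hn, le_rfl⟩)
  simp only [Nat.sub_self, pow_zero, one_mul] at h
  exact h.trans (le_add_of_nonneg_left
    (mul_nonneg (by positivity) (integral_weightedEnergy_nonneg H 1)))

theorem sum_pow_mul_integral_weightedEnergy_le (H : AdmissibleCoefficients C T τ u Ab κb)
    {n m : ℕ} {c : ℝ} (hc : 0 ≤ c) (hmn : m ≤ n + 1)
    (h : ∀ k < m, ∫ s in (0:ℝ)..T, weightedEnergy κb ρb (k + 1) s ≤
      c * energyBound T τ κb ρb k) :
    ∑ k ∈ Finset.Icc 1 m, τ⁻¹ ^ (n + 1 - k) * ∫ s in (0:ℝ)..T, weightedEnergy κb ρb k s ≤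
      m * (c * energyBound T τ κb ρb n) := by
  have hr : 0 < τ⁻¹ := inv_pos.2 H.τ_pos
  refine (Finset.sum_le_card_nsmul _ _ (c * energyBound T τ κb ρb n) fun k hk => ?_).trans
    (le_of_eq (by simp))
  obtain ⟨hk1, hkm⟩ := Finset.mem_Icc.1 hk
  obtain ⟨j, rfl⟩ := Nat.exists_eq_add_of_le' hk1
  rw [show n + 1 - (j + 1) = n - j by omega]
  calc _ ≤ τ⁻¹ ^ (n - j) * (c * energyBound T τ κb ρb j) :=
        mul_le_mul_of_nonneg_left (h j (by omega)) (by positivity)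
    _ = c * (τ⁻¹ ^ (n - j) * energyBound T τ κb ρb j) := by ring
    _ ≤ _ := mul_le_mul_of_nonneg_left (pow_mul_energyBound_le H (by omega)) hc

theorem exists_integral_weightedEnergy_le (C : ℝ) (n : ℕ) : ∃ c : ℝ, 0 ≤ c ∧
    ∀ {T τ : ℝ} {u : ℝ → E3 → E3} {Ab : ℝ → E3 → M3} {κb ρb : ℝ → E3 → ℝ},
      AdmissibleCoefficients C T τ u Ab κb → AdvectionDiffusion T u Ab ρb → ∀ m ≤ n,
        ∫ s in (0:ℝ)..T, weightedEnergy κb ρb (m + 1) s ≤ c * energyBound T τ κb ρb m := by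
  induction n with
  | zero =>
    refine ⟨1, zero_le_one, fun H hρ m hm => ?_⟩
    obtain rfl := Nat.le_zero.1 hm
    simp [energyBound]
  | succ n ih =>
    obtain ⟨c, hc, h⟩ := ih
    obtain ⟨c₀, hc₀, h₀⟩ := exists_weightedEnergy_inequality C n
    refine ⟨c + (2 + 2 * (c₀ * ((n + 1 : ℕ) * c))), by positivity, ?_⟩
    intro T τ u Ab κb ρb H hρ m hm
    have hB := energyBound_nonneg (ρb := ρb) H m
    rcases Nat.of_le_succ hm with hm | rfl
    · have h1 := h H hρ m hm
      have h2 : 0 ≤ (2 + 2 * (c₀ * ((n + 1 : ℕ) * c))) * energyBound T τ κb ρb m := by positivity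
      linarith
    · have hT := h₀ H hρ T ⟨H.T_pos.le, le_rfl⟩
      have h1 := weightedEnergy_nonneg (ρb := ρb) H.κ_pos (n + 1) T
      have h2 := weightedEnergy_zero_le_energyBound (ρb := ρb) H (Nat.succ_pos n)
      have h3 := mul_le_mul_of_nonneg_left (sum_pow_mul_integral_weightedEnergy_le
        (ρb := ρb) H (n := n + 1) (m := n + 1) hc (by omega)
        fun k hk => h H hρ k (by omega)) hc₀
      have h4 := mul_nonneg hc hB
      simp only [Nat.succ_eq_add_one, Nat.add_assoc, Nat.reduceAdd] at *
      linarith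

theorem exists_weightedEnergy_le (C : ℝ) (n : ℕ) : ∃ c : ℝ, 0 ≤ c ∧
    ∀ {T τ : ℝ} {u : ℝ → E3 → E3} {Ab : ℝ → E3 → M3} {κb ρb : ℝ → E3 → ℝ},
      AdmissibleCoefficients C T τ u Ab κb → AdvectionDiffusion T u Ab ρb →
      ∀ t ∈ Icc (0:ℝ) T,
        weightedEnergy κb ρb (n + 1) t ≤ c * energyBound T τ κb ρb (n + 1) := by
  obtain ⟨c, hc, h⟩ := exists_integral_weightedEnergy_le C n
  obtain ⟨c₀, hc₀, h₀⟩ := exists_weightedEnergy_inequality C n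
  refine ⟨1 + c₀ * ((n + 1 : ℕ) * c), by positivity, ?_⟩
  intro T τ u Ab κb ρb H hρ t ht
  have h1 := h₀ H hρ t ht
  have h2 := weightedEnergy_zero_le_energyBound (ρb := ρb) H (Nat.succ_pos n)
  have h3 := mul_le_mul_of_nonneg_left (sum_pow_mul_integral_weightedEnergy_le
    (ρb := ρb) H (n := n + 1) (m := n + 1) hc (by omega) fun k hk => h H hρ k (by omega)) hc₀
  have h4 : 0 ≤ ∫ s in (0:ℝ)..t, weightedEnergy κb ρb (n + 2) s :=
    intervalIntegral.integral_nonneg ht.1 fun s _ => weightedEnergy_nonneg H.κ_pos _ s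
  simp only [Nat.succ_eq_add_one, Nat.add_assoc, Nat.reduceAdd] at *
  linarith

end IntegratedEnergy

section Conversion

variable {C T τ : ℝ} {u : ℝ → E3 → E3} {Ab : ℝ → E3 → M3} {κb ρb : ℝ → E3 → ℝ}

theorem intervalIntegral_le_of_nonneg {f g : ℝ → ℝ} {T : ℝ} (hT : 0 ≤ T) (hf : ∀ s, 0 ≤ f s)
    (hg : Continuous g) (h : ∀ s ∈ Icc (0:ℝ) T, f s ≤ g s) :
    ∫ s in (0:ℝ)..T, f s ≤ ∫ s in (0:ℝ)..T, g s := by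
  rw [intervalIntegral.integral_of_le hT, intervalIntegral.integral_of_le hT]
  refine integral_mono_of_nonneg (Eventually.of_forall hf)
    (hg.intervalIntegrable (μ := volume) 0 T).1 ?_
  filter_upwards [ae_restrict_mem measurableSet_Ioc] with s hs
  exact h s ⟨hs.1.le, hs.2⟩

theorem energyDensity_one (hρ : SmoothTS ρb) (t : ℝ) (x : E3) :
    energyDensity κb ρb 1 t x = κb t x * ∑ i, spd i (ρb t) x ^ 2 := by
  rw [energyDensity, pow_one, sum_sq_wordDeriv_succ (hρ.slice t) 0, Fintype.sum_unique,
    wordDeriv_zero]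

theorem integral_pow_mul_norm_sq_le (hκ : SmoothTS κb) (hκ0 : ∀ t x, 0 < κb t x)
    (hρ : SmoothTS ρb) (n : ℕ) (t : ℝ) :
    ∫ x in cube 3, κb t x ^ n * ‖iteratedFDeriv ℝ n (ρb t) x‖ ^ 2 ≤
      3 ^ n * weightedEnergy κb ρb n t := by
  rw [weightedEnergy, ← integral_const_mul]
  refine integral_mono_of_nonneg (Eventually.of_forall fun x => ?_)
    ((integrableOn_energyDensity hκ hρ n t).const_mul _) (Eventually.of_forall fun x => ?_)
  · exact mul_nonneg (pow_nonneg (hκ0 t x).le _) (sq_nonneg _)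
  · exact (mul_le_mul_of_nonneg_left (sq_norm_iteratedFDeriv_le n (ρb t) x)
      (pow_nonneg (hκ0 t x).le _)).trans_eq (by unfold energyDensity; rw [Nat.cast_ofNat]; ring)

theorem weightedEnergy_le_integral_pow_mul_norm_sq (hκ : SmoothTS κb) (hκ0 : ∀ t x, 0 < κb t x)
    (hρ : SmoothTS ρb) (n : ℕ) (t : ℝ) :
    weightedEnergy κb ρb n t ≤
      3 ^ n * ∫ x in cube 3, κb t x ^ n * ‖iteratedFDeriv ℝ n (ρb t) x‖ ^ 2 := by
  rw [weightedEnergy, ← integral_const_mul]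
  have hc : Continuous fun x => κb t x ^ n * ‖iteratedFDeriv ℝ n (ρb t) x‖ ^ 2 :=
    ((hκ.slice t).continuous.pow n).mul
      (((hρ.slice t).continuous_iteratedFDeriv (by exact_mod_cast le_top)).norm.pow 2)
  refine integral_mono (integrableOn_energyDensity hκ hρ n t)
    ((integrableOn_cube hc).const_mul _) fun x => ?_
  exact (mul_le_mul_of_nonneg_left (sum_sq_wordDeriv_le n (ρb t) x)
    (pow_nonneg (hκ0 t x).le _)).trans_eq (by rw [Nat.cast_ofNat]; ring)

theorem energyBound_le (H : AdmissibleCoefficients C T τ u Ab κb) (hρ : SmoothTS ρb) (n : ℕ) :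
    energyBound T τ κb ρb n ≤ 3 ^ n *
      (τ⁻¹ ^ n * (∫ s in (0:ℝ)..T, ∫ x in cube 3, κb s x * ∑ i, spd i (ρb s) x ^ 2) +
        ∑ i ∈ Finset.Icc 1 n, τ⁻¹ ^ (n - i) *
          ∫ x in cube 3, κb 0 x ^ i * ‖iteratedFDeriv ℝ i (ρb 0) x‖ ^ 2) := by
  have hr : 0 < τ⁻¹ := inv_pos.2 H.τ_pos
  have hX := integral_weightedEnergy_nonneg (ρb := ρb) H 1
  unfold energyBound
  simp only [weightedEnergy, energyDensity_one hρ] at hX ⊢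
  rw [mul_add, Finset.mul_sum]
  refine add_le_add (le_mul_of_one_le_left (by positivity) (one_le_pow₀ (by norm_num)))
    (Finset.sum_le_sum fun i hi => ?_)
  rw [mul_left_comm]
  refine mul_le_mul_of_nonneg_left ?_ (by positivity)
  refine (weightedEnergy_le_integral_pow_mul_norm_sq H.smooth_κ H.κ_pos hρ i 0).trans ?_
  refine mul_le_mul_of_nonneg_right
    (pow_le_pow_right₀ (by norm_num) (Finset.mem_Icc.1 hi).2) ?_
  exact integral_nonneg fun x => mul_nonneg (pow_nonneg (H.κ_pos 0 x).le _) (sq_nonneg _)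

theorem exists_energy_estimate (C : ℝ) (n : ℕ) (hn : 1 ≤ n) : ∃ c : ℝ, 0 ≤ c ∧
    ∀ {T τ : ℝ} {u : ℝ → E3 → E3} {Ab : ℝ → E3 → M3} {κb ρb : ℝ → E3 → ℝ},
      AdmissibleCoefficients C T τ u Ab κb → AdvectionDiffusion T u Ab ρb →
      ∀ t ∈ Icc (0:ℝ) T,
        (∫ x in cube 3, κb t x ^ n * ‖iteratedFDeriv ℝ n (ρb t) x‖ ^ 2) +
            (∫ s in (0:ℝ)..T, ∫ x in cube 3,
              κb s x ^ (n + 1) * ‖iteratedFDeriv ℝ (n + 1) (ρb s) x‖ ^ 2) ≤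
          c * energyBound T τ κb ρb n := by
  obtain ⟨m, rfl⟩ := Nat.exists_eq_add_of_le' hn
  obtain ⟨c₁, hc₁, h₁⟩ := exists_weightedEnergy_le C m
  obtain ⟨c₂, hc₂, h₂⟩ := exists_integral_weightedEnergy_le C (m + 1)
  refine ⟨3 ^ (m + 1) * c₁ + 3 ^ (m + 1 + 1) * c₂, by positivity, ?_⟩
  intro T τ u Ab κb ρb H hρ t ht
  have hle := integral_pow_mul_norm_sq_le H.smooth_κ H.κ_pos hρ.smooth_ρ
  rw [add_mul, mul_assoc, mul_assoc]
  refine add_le_add ((hle _ t).trans (mul_le_mul_of_nonneg_left (h₁ H hρ t ht) (by positivity))) ?_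
  refine (intervalIntegral_le_of_nonneg
    (g := fun s => 3 ^ (m + 1 + 1) * weightedEnergy κb ρb (m + 1 + 1) s) H.T_pos.le (fun s => ?_)
    (continuous_const.mul (continuous_weightedEnergy H.smooth_κ hρ.smooth_ρ _))
    fun s _ => hle _ s).trans ?_
  · exact integral_nonneg fun x => mul_nonneg (pow_nonneg (H.κ_pos s x).le _) (sq_nonneg _)
  · rw [intervalIntegral.integral_const_mul]
    exact mul_le_mul_of_nonneg_left (h₂ H hρ _ le_rfl) (by positivity)

theorem exists_transport_estimate (C : ℝ) (n : ℕ) : ∃ c : ℝ, 0 ≤ c ∧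
    ∀ {T τ : ℝ} {u : ℝ → E3 → E3} {Ab : ℝ → E3 → M3} {κb ρb : ℝ → E3 → ℝ},
      AdmissibleCoefficients C T τ u Ab κb → AdvectionDiffusion T u Ab ρb →
      ∀ I : Fin n → Fin 3,
        ∫ t in (0:ℝ)..T, ∫ x in cube 3,
            κb t x ^ n * matD u (fun s y => wordDeriv I (ρb s) y) t x ^ 2 ≤
          c * energyBound T τ κb ρb (n + 1) := by
  obtain ⟨c₁, hc₁, h₁⟩ := exists_local_matD_bound C n
  obtain ⟨c₂, hc₂, h₂⟩ := exists_integral_weightedEnergy_le C (n + 1)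
  refine ⟨c₁ * ((n + 2 : ℕ) * c₂), by positivity, ?_⟩
  intro T τ u Ab κb ρb H hρ I
  have hcont := continuous_weightedEnergy H.smooth_κ hρ.smooth_ρ
  have hn0 : ∀ t x, 0 ≤ κb t x ^ n * matD u (fun s y => wordDeriv I (ρb s) y) t x ^ 2 :=
    fun t x => mul_nonneg (pow_nonneg (H.κ_pos t x).le _) (sq_nonneg _)
  have hspace : ∀ t ∈ Icc (0:ℝ) T, ∫ x in cube 3,
      κb t x ^ n * matD u (fun s y => wordDeriv I (ρb s) y) t x ^ 2 ≤
        c₁ * ∑ k ∈ Finset.Icc 1 (n + 2), τ⁻¹ ^ (n + 2 - k) * weightedEnergy κb ρb k t := by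
    intro t ht
    rw [← integral_sum_mul_energyDensity H.smooth_κ hρ.smooth_ρ, ← integral_const_mul]
    exact integral_mono_of_nonneg (Eventually.of_forall (hn0 t))
      ((integrable_finsetSum _ fun k _ => (integrableOn_energyDensity H.smooth_κ hρ.smooth_ρ
        k t).const_mul _).const_mul _) (Eventually.of_forall fun x => h₁ H hρ t ht x I)
  refine (intervalIntegral_le_of_nonneg (g := fun t => c₁ * ∑ k ∈ Finset.Icc 1 (n + 2),
      τ⁻¹ ^ (n + 2 - k) * weightedEnergy κb ρb k t) H.T_pos.le (fun t => integral_nonneg (hn0 t))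
    (continuous_const.mul (continuous_finsetSum _ fun k _ =>
      continuous_const.mul (hcont k))) hspace).trans ?_
  rw [intervalIntegral.integral_const_mul, intervalIntegral.integral_finsetSum fun k _ =>
    ((hcont k).intervalIntegrable 0 T).const_mul _]
  simp only [intervalIntegral.integral_const_mul]
  rw [mul_assoc, mul_assoc]
  exact mul_le_mul_of_nonneg_left (sum_pow_mul_integral_weightedEnergy_le H (n := n + 1)
    hc₂ le_rfl fun k hk => h₂ H hρ k (by omega)) hc₁

end Conversion

theorem weighted_energy_estimates (C : ℝ) (hC : 0 < C) :
    ∃ C' : ℕ → ℝ,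
    ∀ T τ : ℝ, 0 < T → 0 < τ →
    ∀ u : ℝ → E3 → E3, SmoothTS u → (∀ t, SpacePeriodic (u t)) →
      (∀ t x, divg (u t) x = 0) →
    ∀ Ab : ℝ → E3 → M3, SmoothTS Ab → (∀ t, SpacePeriodic (Ab t)) →
      (∀ t x i j, Ab t x i j = Ab t x j i) →
    ∀ κb : ℝ → E3 → ℝ, SmoothTS κb → (∀ t, SpacePeriodic (κb t)) →
      (∀ t x, 0 < κb t x) →
    -- (1/2) κ̄ Id ≤ Ā ≤ 2 κ̄ Id
    (∀ t ∈ Icc (0:ℝ) T, ∀ x, ∀ v : Fin 3 → ℝ,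
        (1/2) * κb t x * (∑ i, (v i)^2) ≤ qf (Ab t x) v v ∧
        qf (Ab t x) v v ≤ 2 * κb t x * (∑ i, (v i)^2)) →
    -- ‖D_tκ̄/κ̄‖_{L∞} ≤ C τ⁻¹
    (∀ t ∈ Icc (0:ℝ) T, ∀ x, |matD u κb t x| ≤ C * τ⁻¹ * κb t x) →
    -- ‖κ̄^{(m−2)/2} ∇^m Ā‖_{L∞} ≤ C τ^{−m/2},  ‖κ̄^{(m−2)/2} ∇^m κ̄‖_{L∞} ≤ C τ^{−m/2}
    (∀ m : ℕ, 1 ≤ m → ∀ t ∈ Icc (0:ℝ) T, ∀ x,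
        (κb t x) ^ (((m:ℝ) - 2)/2) * ‖iteratedFDeriv ℝ m (Ab t) x‖
          ≤ C * τ⁻¹ ^ ((m:ℝ)/2) ∧
        (κb t x) ^ (((m:ℝ) - 2)/2) * ‖iteratedFDeriv ℝ m (κb t) x‖
          ≤ C * τ⁻¹ ^ ((m:ℝ)/2)) →
    -- ‖κ̄^{(m−1)/2} ∇^m u‖_{L∞} ≤ C τ⁻¹ τ^{−(m−1)/2}
    (∀ m : ℕ, 1 ≤ m → ∀ t ∈ Icc (0:ℝ) T, ∀ x,
        (κb t x) ^ (((m:ℝ) - 1)/2) * ‖iteratedFDeriv ℝ m (u t) x‖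
          ≤ C * τ⁻¹ * τ⁻¹ ^ (((m:ℝ) - 1)/2)) →
    ∀ ρb : ℝ → E3 → ℝ, SmoothTS ρb → (∀ t, SpacePeriodic (ρb t)) →
      -- ρ̄ solves ∂ₜρ̄ + u·∇ρ̄ = div(Ā∇ρ̄)
      (∀ t ∈ Icc (0:ℝ) T, ∀ x,
        deriv (fun s => ρb s x) t + ∑ i, u t x i * spd i (ρb t) x
          = ∑ i, spd i (fun y => ∑ j, Ab t y i j * spd j (ρb t) y) x) →
    ∀ n : ℕ, 1 ≤ n →
      -- first conclusion: sup-in-time weighted estimate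
      (∀ t ∈ Icc (0:ℝ) T,
          (∫ x in cube 3, (κb t x)^n * ‖iteratedFDeriv ℝ n (ρb t) x‖^2)
            + (∫ s in (0:ℝ)..T, ∫ x in cube 3,
                (κb s x)^(n+1) * ‖iteratedFDeriv ℝ (n+1) (ρb s) x‖^2)
            ≤ C' n * ((τ⁻¹)^n * (∫ s in (0:ℝ)..T, ∫ x in cube 3,
                  κb s x * ∑ i, (spd i (ρb s) x)^2)
                + ∑ i ∈ Finset.Icc 1 n, (τ⁻¹)^(n-i) *
                    (∫ x in cube 3, (κb 0 x)^i * ‖iteratedFDeriv ℝ i (ρb 0) x‖^2))) ∧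
      -- second conclusion: transport estimate, for every multi-index α with |α| = n
      (∀ α : Fin 3 → ℕ, (∑ i, α i) = n →
        (∫ t in (0:ℝ)..T, ∫ x in cube 3,
            (κb t x)^n * (matD u (fun s y => pdMulti α (ρb s) y) t x)^2)
          ≤ C' n * ((τ⁻¹)^(n+1) * (∫ s in (0:ℝ)..T, ∫ x in cube 3,
                κb s x * ∑ i, (spd i (ρb s) x)^2)
              + ∑ i ∈ Finset.Icc 1 (n+1), (τ⁻¹)^(n+1-i) *
                  (∫ x in cube 3, (κb 0 x)^i * ‖iteratedFDeriv ℝ i (ρb 0) x‖^2))) := by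
  choose a ha hE using fun n : ℕ => exists_energy_estimate C (n + 1) n.succ_pos
  choose b hb hD using exists_transport_estimate C
  refine ⟨fun n => 3 ^ n * a (n - 1) + 3 ^ (n + 1) * b n, ?_⟩
  intro T τ hT hτ u hu hup hdiv Ab hA hAp hAs κb hκ hκp hκ0 hell hDκ hAκ hum ρb hρ hρp heq n hn
  have H : AdmissibleCoefficients C T τ u Ab κb :=
    ⟨hC, hT, hτ, hu, hup, hdiv, hA, hAp, hAs, hκ, hκp, hκ0, hell, hDκ, hAκ, hum⟩
  have hsol : AdvectionDiffusion T u Ab ρb := ⟨hρ, hρp, heq⟩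
  have hbound := energyBound_le H hρ
  have hnonneg := fun k => nonneg_of_mul_nonneg_right
    ((energyBound_nonneg (ρb := ρb) H k).trans (hbound k)) (by positivity)
  constructor
  · intro t ht
    have h := hE (n - 1) H hsol t ht
    rw [Nat.sub_add_cancel hn] at h
    refine h.trans ((mul_le_mul_of_nonneg_left (hbound n) (ha _)).trans ?_)
    rw [← mul_assoc]
    refine mul_le_mul_of_nonneg_right ?_ (hnonneg n)
    have := mul_nonneg (by positivity : (0:ℝ) ≤ 3 ^ (n + 1)) (hb n)
    linarith
  · rintro α rfl
    obtain ⟨I, hI⟩ := exists_wordDeriv_eq_pdMulti α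
    have e : (fun s y => pdMulti α (ρb s) y) = fun s y => wordDeriv I (ρb s) y :=
      funext fun s => hI (ρb s) (hρ.slice s)
    rw [e]
    refine (hD _ H hsol I).trans ((mul_le_mul_of_nonneg_left (hbound _) (hb _)).trans ?_)
    rw [← mul_assoc]
    refine mul_le_mul_of_nonneg_right ?_ (hnonneg _)
    have := mul_nonneg (by positivity : (0:ℝ) ≤ 3 ^ (∑ i, α i)) (ha ((∑ i, α i) - 1))
    linarith

end
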